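/- arXiv:1012.1433 — 2 statements merged into one kernel-verified Lean document; each statement's English description precedes it below -/
import Mathlib

section
/- For every n and every degree i ≥ 0 with 2i ≤ n − 4, the group cohomology H^i(Aut(F_n); H^*) is zero, where H^* is the dual of the abelianization of the free group F_n with its natural Aut(F_n)-action. -/
open CategoryTheory

noncomputable section

/-- The free group on `n` generators. -/
abbrev FreeGrp (n : ℕ) : Type := FreeGroup (Fin n)

/-- The automorphism group `Aut(F_n)` of the free group on `n` generators. -/
abbrev AutF (n : ℕ) : Type := MulAut (FreeGrp n)

/-- The abelianization `H = F_n/[F_n,F_n]`, written additively, as a `ℤ`-module. -/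
abbrev AbH (n : ℕ) : Type := Additive (Abelianization (FreeGrp n))

/-- The natural action of `Aut(F_n)` on the abelianization `H`, as a `ℤ`-linear
representation. -/
def abRep (n : ℕ) : Representation ℤ (AutF n) (AbH n) where
  toFun φ := (MonoidHom.toAdditive (Abelianization.map φ.toMonoidHom)).toIntLinearMap
  map_one' := by
    ext x
    show MonoidHom.toAdditive (Abelianization.map (MulEquiv.toMonoidHom (1 : AutF n))) x = x
    rw [show MulEquiv.toMonoidHom (1 : AutF n) = MonoidHom.id _ from rfl, Abelianization.map_id]
    rfl
  map_mul' φ ψ := by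
    ext x
    show MonoidHom.toAdditive (Abelianization.map (MulEquiv.toMonoidHom (φ * ψ))) x =
      MonoidHom.toAdditive (Abelianization.map φ.toMonoidHom)
        (MonoidHom.toAdditive (Abelianization.map ψ.toMonoidHom) x)
    rw [show MulEquiv.toMonoidHom (φ * ψ) = φ.toMonoidHom.comp ψ.toMonoidHom from rfl,
      ← Abelianization.map_comp]
    rfl

/-- The dual module `H^* = Hom_ℤ(H, ℤ)` with the contragredient `Aut(F_n)`-action,
as an object of `Rep ℤ (Aut F_n)`. -/
def dualRepAut (n : ℕ) : Rep ℤ (AutF n) := Rep.of (abRep n).dual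

namespace GroupCochain

section Basic

variable {G V : Type} [Group G] [AddCommGroup V]

/-- The differential on inhomogeneous cochains. -/
def cobd (ρ : Representation ℤ G V) (k : ℕ) :
    ((Fin k → G) → V) →+ ((Fin (k + 1) → G) → V) :=
  AddMonoidHom.mk'
    (fun f g => ρ (g 0) (f fun i => g i.succ) +
      ∑ j : Fin (k + 1), (-1 : ℤ) ^ ((j : ℕ) + 1) • f (Fin.contractNth j (· * ·) g)) (by
    intro f f'
    ext g
    simp only [Pi.add_apply, map_add, smul_add, Finset.sum_add_distrib]
    abel)

theorem cobd_apply (ρ : Representation ℤ G V) (k : ℕ) (f : (Fin k → G) → V)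
    (g : Fin (k + 1) → G) :
    cobd ρ k f g = ρ (g 0) (f fun i => g i.succ) +
      ∑ j : Fin (k + 1), (-1 : ℤ) ^ ((j : ℕ) + 1) • f (Fin.contractNth j (· * ·) g) := rfl

theorem d_eq_cobd (ρ : Representation ℤ G V) (k : ℕ) (f : (Fin k → G) → V) :
    (groupCohomology.inhomogeneousCochains (Rep.of ρ)).d k (k + 1) f = cobd ρ k f := by
  ext g
  rw [groupCohomology.inhomogeneousCochains.d_def]
  rfl

theorem cobd_cobd (ρ : Representation ℤ G V) (k : ℕ) (f : (Fin k → G) → V) :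
    cobd ρ (k + 1) (cobd ρ k f) = 0 := by
  rw [← d_eq_cobd, ← d_eq_cobd, ← ModuleCat.comp_apply, HomologicalComplex.d_comp_d]
  rfl

theorem cobd_zero_apply (ρ : Representation ℤ G V) (f : (Fin 0 → G) → V) (g : Fin 1 → G) :
    cobd ρ 0 f g = ρ (g 0) (f default) - f default := by
  rw [cobd_apply, sub_eq_add_neg]
  congr 1
  · congr 2
    exact Subsingleton.elim _ _
  · rw [Fin.sum_univ_succ, Fin.sum_univ_zero, add_zero, Fin.val_zero,
      show (-1 : ℤ) ^ (0 + 1) = -1 from rfl, neg_smul,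
      one_smul]
    congr 2
    exact Subsingleton.elim _ _

theorem cobd_comp {G' V' : Type} [Group G'] [AddCommGroup V'] (ρ : Representation ℤ G V)
    (ρ' : Representation ℤ G' V') (φ : G' →* G) (π : V →+ V')
    (h : ∀ g v, π (ρ (φ g) v) = ρ' g (π v)) (k : ℕ) (f : (Fin k → G) → V) :
    cobd ρ' k (fun g => π (f (φ ∘ g))) = fun g => π (cobd ρ k f (φ ∘ g)) := by
  ext g
  rw [cobd_apply, cobd_apply, map_add, map_sum]
  congr 1
  · rw [Function.comp_apply, h]; rfl
  · refine Finset.sum_congr rfl fun j _ => ?_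
    rw [map_zsmul, Fin.comp_contractNth (opβ := (· * ·)) _ (fun x y => map_mul φ x y)]

theorem cobd_map {V' : Type} [AddCommGroup V'] (ρ : Representation ℤ G V)
    (ρ' : Representation ℤ G V') (π : V →+ V')
    (h : ∀ g v, π (ρ g v) = ρ' g (π v)) (k : ℕ) (f : (Fin k → G) → V) :
    cobd ρ' k (fun g => π (f g)) = fun g => π (cobd ρ k f g) :=
  cobd_comp ρ ρ' (MonoidHom.id G) π h k f

/-- A cochain is a coboundary; in degree zero this means that it vanishes. -/
def IsCobd (ρ : Representation ℤ G V) : (k : ℕ) → ((Fin k → G) → V) → Prop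
  | 0, c => c = 0
  | k + 1, c => ∃ e, cobd ρ k e = c

/-- Vanishing of cohomology in degree `k`, in terms of cochains. -/
def Van (ρ : Representation ℤ G V) (k : ℕ) : Prop :=
  ∀ c, cobd ρ k c = 0 → IsCobd ρ k c

theorem isZero_of_van (ρ : Representation ℤ G V) (k : ℕ) (h : Van ρ k) :
    Limits.IsZero (groupCohomology (Rep.of ρ) k) := by
  rw [groupCohomology, ← HomologicalComplex.exactAt_iff_isZero_homology]
  cases k with
  | zero =>
    rw [HomologicalComplex.exactAt_iff' _ 0 0 1 (by simp) (by simp),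
      ShortComplex.moduleCat_exact_iff]
    intro x hx
    have := h x ((d_eq_cobd ρ 0 x).symm.trans hx)
    exact ⟨0, by rw [map_zero]; exact this.symm⟩
  | succ k =>
    rw [HomologicalComplex.exactAt_iff' _ k (k + 1) (k + 2) (by simp) (by simp),
      ShortComplex.moduleCat_exact_iff]
    intro x hx
    obtain ⟨e, he⟩ := h x ((d_eq_cobd ρ (k + 1) x).symm.trans hx)
    exact ⟨e, (d_eq_cobd ρ k e).trans he⟩

theorem Van.transport {G' V' : Type} [Group G'] [AddCommGroup V'] {ρ : Representation ℤ G V}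
    {ρ' : Representation ℤ G' V'} (φ : G' ≃* G) (π : V ≃+ V')
    (h : ∀ g v, π (ρ (φ g) v) = ρ' g (π v)) {k : ℕ} (hv : Van ρ k) : Van ρ' k := by
  intro c hc
  have h' : ∀ g v, π.symm (ρ' (φ.symm g) v) = ρ g (π.symm v) := by
    intro g v
    rw [AddEquiv.symm_apply_eq, ← φ.apply_symm_apply g, h]
    simp
  have key := cobd_comp ρ' ρ φ.symm.toMonoidHom π.symm.toAddMonoidHom h' k c
  have := hv _ (key.trans (by rw [hc]; ext; simp))
  have hid : ∀ (m : ℕ) (g : Fin m → G'), φ.symm ∘ (φ ∘ g) = g := fun m g => by ext; simp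
  cases k with
  | zero =>
    ext g
    have := congrFun this (φ ∘ g)
    simpa [Function.comp_def] using this
  | succ k =>
    obtain ⟨e, he⟩ := this
    refine ⟨fun g => π (e (φ ∘ g)), ?_⟩
    refine (cobd_comp ρ ρ' φ.toMonoidHom π.toAddMonoidHom h k e).trans ?_
    ext g
    rw [he]
    simp [Function.comp_def]

end Basic

section Functions

variable {G : Type} [Group G] (A : Type) [AddCommGroup A]

/-- Functions on the group, with the action by right translation. -/
def funRep (G : Type) [Group G] (A : Type) [AddCommGroup A] : Representation ℤ G (G → A) where
  toFun g := { toFun := fun f x => f (x * g), map_add' := fun _ _ => rfl,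
               map_smul' := fun _ _ => rfl }
  map_one' := by ext f x; simp
  map_mul' g h := by ext f x; simp [mul_assoc]

variable {A}

@[simp] theorem funRep_apply (g : G) (f : G → A) (x : G) : funRep G A g f x = f (x * g) := rfl

theorem cobd_cons {V : Type} [AddCommGroup V] (ρ : Representation ℤ G V) (k : ℕ)
    (f : (Fin (k + 1) → G) → V) (x : G) (g : Fin (k + 1) → G) :
    cobd ρ (k + 1) f (Fin.cons x g) = ρ x (f g) -
      (f (Fin.cons (x * g 0) fun i => g i.succ) +
        ∑ j : Fin (k + 1), (-1 : ℤ) ^ ((j : ℕ) + 1) •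
          f (Fin.cons x (Fin.contractNth j (· * ·) g))) := by
  rw [cobd_apply, Fin.sum_univ_succ, sub_eq_add_neg, neg_add, ← Finset.sum_neg_distrib]
  congr 1
  congr 1
  · simp only [Fin.val_zero, zero_add, pow_one, neg_smul, one_smul, neg_inj]
    congr 1
    ext i
    refine Fin.cases ?_ (fun i => ?_) i
    · rw [Fin.contractNth_apply_of_eq _ _ _ _ rfl]; simp
    · rw [Fin.contractNth_apply_of_gt _ _ _ _ (by simp)]; simp
  · refine Finset.sum_congr rfl fun j _ => ?_
    rw [Fin.val_succ, pow_succ, mul_neg_one, neg_smul]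
    congr 3
    ext i
    refine Fin.cases ?_ (fun i => ?_) i
    · rw [Fin.contractNth_apply_of_lt _ _ _ _ (by simp)]; simp
    · simp only [Fin.contractNth, Fin.val_succ, add_lt_add_iff_right, add_left_inj, Fin.cons_succ,
        ← Fin.succ_castSucc]

/-- The contracting homotopy for cochains with values in functions on the group. -/
theorem cobd_funRep_homotopy (k : ℕ) (f : (Fin (k + 1) → G) → (G → A))
    (hf : cobd (funRep G A) (k + 1) f = 0) :
    cobd (funRep G A) k (fun g x => f (Fin.cons x g) 1) = f := by
  ext g x
  have h := congrFun (congrFun hf (Fin.cons x g)) 1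
  rw [cobd_cons] at h
  simp only [Pi.sub_apply, funRep_apply, Pi.add_apply, Pi.zero_apply, one_mul, sub_eq_zero] at h
  rw [h, cobd_apply]
  simp only [Pi.add_apply, funRep_apply]
  simp [Finset.sum_apply]

end Functions

end GroupCochain

namespace GroupCochain

section Shift

variable {G V : Type} [Group G] [AddCommGroup V]

theorem exists_quotient (ρ : Representation ℤ G V) (W : AddSubgroup V)
    (hW : ∀ g, ∀ v ∈ W, ρ g v ∈ W) :
    ∃ (Q : Type) (_ : AddCommGroup Q) (σ : Representation ℤ G Q) (π : V →+ Q),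
      Function.Surjective π ∧ (∀ g v, π (ρ g v) = σ g (π v)) ∧ ∀ v, π v = 0 ↔ v ∈ W := by
  refine ⟨V ⧸ W, inferInstance,
    { toFun := fun g => (QuotientAddGroup.map W W (ρ g).toAddMonoidHom
        (fun v hv => hW g v hv)).toIntLinearMap
      map_one' := ?_
      map_mul' := ?_ }, QuotientAddGroup.mk' W, QuotientAddGroup.mk'_surjective W,
      fun g v => rfl, fun v => QuotientAddGroup.eq_zero_iff v⟩
  · ext v
    induction v using QuotientAddGroup.induction_on with
    | H v =>
      change ((ρ 1 v : V) : V ⧸ W) = v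
      simp
  · intro g h
    ext v
    induction v using QuotientAddGroup.induction_on with
    | H v =>
      change ((ρ (g * h) v : V) : V ⧸ W) = ((ρ g (ρ h v) : V) : V ⧸ W)
      simp

/-- The equivariant embedding of a module into the functions on the group. -/
def orbitMap (ρ : Representation ℤ G V) : V →+ (G → V) :=
  AddMonoidHom.mk' (fun v x => ρ x v) (by intro v w; ext x; simp)

@[simp] theorem orbitMap_apply (ρ : Representation ℤ G V) (v : V) (x : G) :
    orbitMap ρ v x = ρ x v := rfl

theorem orbitMap_equivariant (ρ : Representation ℤ G V) (g : G) (v : V) :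
    orbitMap ρ (ρ g v) = funRep G V g (orbitMap ρ v) := by
  ext x; simp

theorem orbitMap_injective (ρ : Representation ℤ G V) : Function.Injective (orbitMap ρ) := by
  intro v w h
  simpa using congrFun h 1

/-- The cokernel of the embedding of a module into the functions on the group. -/
theorem exists_shift (ρ : Representation ℤ G V) :
    ∃ (Q : Type) (_ : AddCommGroup Q) (σ : Representation ℤ G Q) (π : (G → V) →+ Q),
      Function.Surjective π ∧ (∀ g v, π (funRep G V g v) = σ g (π v)) ∧
        ∀ v, π v = 0 ↔ ∃ w, orbitMap ρ w = v := by
  obtain ⟨Q, iQ, σ, π, h1, h2, h3⟩ := exists_quotient (funRep G V) (orbitMap ρ).range (by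
    rintro g v ⟨w, rfl⟩
    exact ⟨ρ g w, orbitMap_equivariant ρ g w⟩)
  exact ⟨Q, iQ, σ, π, h1, h2, h3⟩

end Shift

section Shapiro

variable {G G' : Type} [Group G] [Group G'] (ι : G' →* G)

/-- Membership in the coinduced module. -/
def IsEqui {A : Type} [AddCommGroup A] (σ : Representation ℤ G' A) (E : G → A) : Prop :=
  ∀ ψ x, E (ι ψ * x) = σ ψ (E x)

/-- Being the coboundary of a cochain with values in the coinduced module. -/
def IsEquiCobd {A : Type} [AddCommGroup A] (σ : Representation ℤ G' A) :
    (k : ℕ) → ((Fin k → G) → (G → A)) → Prop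
  | 0, c => c = 0
  | k + 1, c => ∃ e, (∀ g, IsEqui ι σ (e g)) ∧ cobd (funRep G A) k e = c

variable {ι}

theorem IsEqui.exists_lift (hι : Function.Injective ι) {A B : Type} [AddCommGroup A]
    [AddCommGroup B] {σ : Representation ℤ G' A} {τ : Representation ℤ G' B} (π : A →+ B)
    (hπ : Function.Surjective π) (he : ∀ g v, π (σ g v) = τ g (π v)) {E : G → B}
    (hE : IsEqui ι τ E) : ∃ E' : G → A, IsEqui ι σ E' ∧ ∀ x, π (E' x) = E x := by
  let r : G → G := fun x => (Quotient.mk (QuotientGroup.rightRel ι.range) x).out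
  have hr : ∀ ψ x, r (ι ψ * x) = r x := by
    intro ψ x
    refine congrArg Quotient.out (Quotient.sound (QuotientGroup.rightRel_apply.2 ?_))
    exact ⟨ψ⁻¹, by simp⟩
  have hp : ∀ x, ∃ ψ, ι ψ * r x = x := by
    intro x
    have h : (QuotientGroup.rightRel ι.range) (r x) x :=
      Quotient.exact (Quotient.out_eq (Quotient.mk (QuotientGroup.rightRel ι.range) x))
    obtain ⟨ψ, h⟩ := QuotientGroup.rightRel_apply.1 h
    exact ⟨ψ, by rw [h]; group⟩
  choose p hp using hp
  have hpm : ∀ ψ x, p (ι ψ * x) = ψ * p x := by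
    intro ψ x
    apply hι
    rw [map_mul, ← mul_left_inj (r x), mul_assoc, hp, ← hr ψ x, hp]
  choose s hs using hπ
  refine ⟨fun x => σ (p x) (s (E (r x))), ?_, ?_⟩
  · intro ψ x
    simp only [hpm, hr, map_mul, Module.End.mul_apply]
  · intro x
    rw [he, hs, ← hE, hp]

theorem IsEqui.cobd {A : Type} [AddCommGroup A] {σ : Representation ℤ G' A} {k : ℕ}
    {e : (Fin k → G) → (G → A)} (he : ∀ g, IsEqui ι σ (e g)) (g : Fin (k + 1) → G) :
    IsEqui ι σ (cobd (funRep G A) k e g) := by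
  intro ψ x
  simp only [cobd_apply, Pi.add_apply, funRep_apply, Finset.sum_apply, Pi.smul_apply, map_add,
    map_sum, map_zsmul]
  congr 1
  · rw [mul_assoc, he]
  · exact Finset.sum_congr rfl fun j _ => by rw [he]

/-- Precomposition with left translations, from functions on `G` to functions on `G × G'`. -/
def spread (ι : G' →* G) (A : Type) [AddCommGroup A] : (G → A) →+ (G → (G' → A)) :=
  AddMonoidHom.mk' (fun F x y => F (ι y * x)) (fun _ _ => rfl)

/-- Postcomposition. -/
def postcomp (G : Type) {A B : Type} [AddCommGroup A] [AddCommGroup B] (π : A →+ B) :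
    (G → A) →+ (G → B) :=
  AddMonoidHom.mk' (fun F x => π (F x)) (by intro F F'; ext; simp)

theorem cobd_postcomp {A B : Type} [AddCommGroup A] [AddCommGroup B] (π : A →+ B) (k : ℕ)
    (f : (Fin k → G) → (G → A)) :
    cobd (funRep G B) k (fun g x => π (f g x)) = fun g x => π (cobd (funRep G A) k f g x) :=
  cobd_map (funRep G A) (funRep G B) (postcomp G π) (fun _ _ => rfl) k f

theorem cobd_eval {A : Type} [AddCommGroup A] {σ : Representation ℤ G' A} {k : ℕ}
    {f : (Fin k → G) → (G → A)} (hf : ∀ g, IsEqui ι σ (f g)) :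
    cobd σ k (fun g => f (ι ∘ g) 1) = fun g => cobd (funRep G A) k f (ι ∘ g) 1 := by
  ext g
  rw [cobd_apply, cobd_apply]
  simp only [Pi.add_apply, funRep_apply, Finset.sum_apply, Pi.smul_apply]
  congr 1
  · rw [← hf]
    simp only [mul_one, one_mul, Function.comp_apply]
    rfl
  · refine Finset.sum_congr rfl fun j _ => ?_
    rw [Fin.comp_contractNth (opβ := (· * ·)) _ (fun x y => map_mul ι x y)]

theorem IsEqui.sub {A : Type} [AddCommGroup A] {σ : Representation ℤ G' A} {E F : G → A}
    (hE : IsEqui ι σ E) (hF : IsEqui ι σ F) : IsEqui ι σ (E - F) := by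
  intro ψ x
  simp [hE ψ x, hF ψ x]

theorem exists_desc_of_map_eq_zero {A : Type} [AddCommGroup A] {σ : Representation ℤ G' A}
    {Q : Type} [AddCommGroup Q] {π : (G' → A) →+ Q}
    (hπ : ∀ v, π v = 0 ↔ ∃ w, orbitMap σ w = v) {k : ℕ}
    {f : (Fin (k + 1) → G) → (G → A)} {b : (Fin k → G) → (G → (G' → A))}
    (hb : ∀ g, IsEqui ι (funRep G' A) (b g))
    (hbf : cobd (funRep G (G' → A)) k b = fun g x => orbitMap σ (f g x))
    (h0 : ∀ g x, π (b g x) = 0) : IsEquiCobd ι σ (k + 1) f := by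
  have h1 : ∀ g x, ∃ w, orbitMap σ w = b g x := fun g x => (hπ _).1 (h0 g x)
  choose e he using h1
  refine ⟨e, fun g ψ x => orbitMap_injective σ ?_, ?_⟩
  · rw [he, hb, orbitMap_equivariant, he]
  · ext g x
    apply orbitMap_injective σ
    rw [← congrFun (congrFun (cobd_postcomp (orbitMap σ) k e) g) x]
    simp only [he]
    exact congrFun (congrFun hbf g) x

/-- Injectivity in Shapiro's lemma. -/
theorem isEquiCobd_of_eval (hι : Function.Injective ι) (k : ℕ) :
    ∀ {A : Type} [AddCommGroup A] (σ : Representation ℤ G' A) (f : (Fin k → G) → (G → A)),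
      (∀ g, IsEqui ι σ (f g)) → cobd (funRep G A) k f = 0 →
      IsCobd σ k (fun g => f (ι ∘ g) 1) → IsEquiCobd ι σ k f := by
  induction k with
  | zero =>
    intro A _ σ f hf hc h
    ext g x
    have h1 := congrFun (congrFun hc fun _ => x) 1
    rw [cobd_zero_apply] at h1
    have h2 : f default 1 = 0 := by
      rw [← Subsingleton.elim (ι ∘ default) default]
      exact congrFun h default
    simpa [h2, Subsingleton.elim g default] using h1
  | succ k ih =>
    intro A _ σ f hf hc h
    obtain ⟨a, ha⟩ := h
    obtain ⟨Q, iQ, τ, π, hs, he, hk⟩ := exists_shift σ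
    have hπi : ∀ w, π (orbitMap σ w) = 0 := fun w => (hk _).2 ⟨w, rfl⟩
    suffices hmain : ∃ b : (Fin k → G) → (G → (G' → A)),
        (∀ g, IsEqui ι (funRep G' A) (b g)) ∧
        cobd (funRep G (G' → A)) k b = (fun g x => orbitMap σ (f g x)) ∧
        IsCobd τ k (fun g => π (b (ι ∘ g) 1)) by
      obtain ⟨b, hb, hbf, hcb⟩ := hmain
      have hb' : ∀ g, IsEqui ι τ (fun x => π (b g x)) := by
        intro g ψ x
        simp only [hb g ψ x, he]
      have := ih τ (fun g x => π (b g x)) hb' (by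
        rw [cobd_postcomp, hbf]
        ext g x
        exact hπi _) hcb
      cases k with
      | zero => exact exists_desc_of_map_eq_zero hk hb hbf fun g x =>
          congrFun (congrFun this g) x
      | succ k =>
        obtain ⟨e, hee, heb⟩ := this
        choose e' he' hee' using fun g => (hee g).exists_lift hι π hs he
        refine exists_desc_of_map_eq_zero (b := b - cobd (funRep G (G' → A)) k e') hk
          (fun g => (hb g).sub (IsEqui.cobd he' g)) (by rw [map_sub, cobd_cobd, sub_zero, hbf]) ?_
        intro g x
        rw [Pi.sub_apply, Pi.sub_apply, map_sub, sub_eq_zero,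
          ← congrFun (congrFun (cobd_postcomp π k e') g) x]
        simp only [hee']
        rw [heb]
    let b : (Fin k → G) → (G → (G' → A)) := fun g x y => f (Fin.cons (ι y * x) g) 1
    have hb : ∀ g, IsEqui ι (funRep G' A) (b g) := by
      intro g ψ x
      ext y
      simp [b, mul_assoc]
    have hbf : cobd (funRep G (G' → A)) k b = (fun g x => orbitMap σ (f g x)) := by
      refine (cobd_map (funRep G A) (funRep G (G' → A)) (spread ι A)
        (fun g F => by ext x y; simp [spread, mul_assoc]) k
        (fun g x => f (Fin.cons x g) 1)).trans ?_
      rw [cobd_funRep_homotopy k f hc]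
      ext g x y
      exact hf g y x
    have hev : cobd (funRep G' A) k (fun g => b (ι ∘ g) 1 - orbitMap σ (a g)) = 0 := by
      rw [show (fun g => b (ι ∘ g) 1 - orbitMap σ (a g)) =
        (fun g => b (ι ∘ g) 1) - fun g => orbitMap σ (a g) from rfl, map_sub,
        cobd_map σ (funRep G' A) (orbitMap σ) (fun g v => orbitMap_equivariant σ g v),
        cobd_eval hb, hbf, ha]
      exact sub_self _
    cases k with
    | zero =>
      set y := b default 1 - orbitMap σ (a default) with hy
      have hyi : ∀ ψ, funRep G' A ψ y = y := by
        intro ψ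
        have := congrFun hev fun _ => ψ
        rw [cobd_zero_apply, Pi.zero_apply, sub_eq_zero] at this
        rw [Subsingleton.elim (ι ∘ default) default] at this
        exact this
      refine ⟨fun g x => b g x - y, fun g => ?_, ?_, ?_⟩
      · intro ψ x
        simp only [hb g ψ x, map_sub, hyi]
      · rw [← hbf]
        ext g : 1
        rw [cobd_zero_apply, cobd_zero_apply]
        ext x : 1
        simp
      · ext g
        rw [Subsingleton.elim (ι ∘ g) default]
        simp only [hy, sub_sub_cancel]
        exact hπi _
    | succ k =>
      refine ⟨b, hb, hbf, ⟨fun g => π (fun x => b (ι ∘ Fin.cons x g) 1 1 -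
        orbitMap σ (a (Fin.cons x g)) 1), ?_⟩⟩
      rw [cobd_map (funRep G' A) τ π he]
      have := cobd_funRep_homotopy k _ hev
      simp only [Pi.sub_apply] at this
      rw [this]
      ext g
      rw [map_sub, hπi, sub_zero]

end Shapiro

end GroupCochain

namespace GroupCochain

theorem cobd_mem {G V : Type} [Group G] [AddCommGroup V] {ρ : Representation ℤ G V}
    {W : AddSubgroup V} (hW : ∀ g, ∀ v ∈ W, ρ g v ∈ W) {k : ℕ} {f : (Fin k → G) → V}
    (hf : ∀ g, f g ∈ W) (g : Fin (k + 1) → G) : cobd ρ k f g ∈ W := by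
  rw [cobd_apply]
  exact W.add_mem (hW _ _ (hf _)) (W.sum_mem fun j _ => W.zsmul_mem (hf _) _)

section Derivations

variable {G β : Type} [Group G] (t : FreeGroup β →* G)

/-- The derivations from a free group to a module. -/
def derivations {N : Type} [AddCommGroup N] (ρ : Representation ℤ G N) :
    AddSubgroup (FreeGroup β → N) where
  carrier := {δ | ∀ w w', δ (w * w') = δ w + ρ (t w) (δ w')}
  add_mem' := by
    intro a b ha hb w w'
    simp only [Pi.add_apply, ha w w', hb w w', map_add]
    abel
  zero_mem' := by intro w w'; simp
  neg_mem' := by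
    intro a ha w w'
    simp only [Pi.neg_apply, ha w w', map_neg]
    abel

variable {t}

theorem derivation_one {N : Type} [AddCommGroup N] {ρ : Representation ℤ G N}
    {δ : FreeGroup β → N} (h : δ ∈ derivations t ρ) : δ 1 = 0 := by
  have := h 1 1
  simpa using this

theorem derivation_ext {N : Type} [AddCommGroup N] {ρ : Representation ℤ G N}
    {δ δ' : FreeGroup β → N} (h : δ ∈ derivations t ρ) (h' : δ' ∈ derivations t ρ)
    (hof : ∀ b, δ (FreeGroup.of b) = δ' (FreeGroup.of b)) : δ = δ' := by
  ext w
  induction w using FreeGroup.induction_on with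
  | C1 => rw [derivation_one h, derivation_one h']
  | of b => exact hof b
  | inv_of b hb =>
    have e := h (FreeGroup.of b)⁻¹ (FreeGroup.of b)
    have e' := h' (FreeGroup.of b)⁻¹ (FreeGroup.of b)
    rw [inv_mul_cancel, derivation_one h] at e
    rw [inv_mul_cancel, derivation_one h', ← hb, e] at e'
    exact add_right_cancel e'
  | mul x y hx hy => rw [h, h', hx, hy]

theorem exists_derivation {N : Type} [AddCommGroup N] (ρ : Representation ℤ G N) (v : β → N) :
    ∃ δ ∈ derivations t ρ, ∀ b, δ (FreeGroup.of b) = v b := by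
  let P : β → Equiv.Perm N := fun b =>
    { toFun := fun n => ρ (t (FreeGroup.of b)) n + v b
      invFun := fun n => ρ (t (FreeGroup.of b))⁻¹ (n - v b)
      left_inv := fun n => by simp
      right_inv := fun n => by simp }
  have key : ∀ w n, FreeGroup.lift P w n = ρ (t w) n + FreeGroup.lift P w 0 := by
    intro w
    induction w using FreeGroup.induction_on with
    | C1 => intro n; simp
    | of b => intro n; simp [P]
    | inv_of b hb =>
      intro n
      simp only [map_inv, FreeGroup.lift_apply_of, Equiv.Perm.inv_def]
      simp [P, sub_eq_add_neg]
    | mul x y hx hy =>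
      intro n
      rw [map_mul, Equiv.Perm.mul_apply, Equiv.Perm.mul_apply, hx, hy n, hx (FreeGroup.lift P y 0)]
      simp [add_assoc]
  refine ⟨fun w => FreeGroup.lift P w 0, fun w w' => ?_, fun b => by simp [P]⟩
  change FreeGroup.lift P (w * w') 0 = _
  rw [map_mul, Equiv.Perm.mul_apply, key, add_comm]

theorem derivation_map {N Q : Type} [AddCommGroup N] [AddCommGroup Q] {ρ : Representation ℤ G N}
    {σ : Representation ℤ G Q} {π : N →+ Q} (he : ∀ g v, π (ρ g v) = σ g (π v))
    {δ : FreeGroup β → N} (h : δ ∈ derivations t ρ) : (fun w => π (δ w)) ∈ derivations t σ := by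
  intro w w'
  simp only [h w w', map_add, he]

theorem exists_derivation_lift {N Q : Type} [AddCommGroup N] [AddCommGroup Q]
    {ρ : Representation ℤ G N}
    {σ : Representation ℤ G Q} {π : N →+ Q} (he : ∀ g v, π (ρ g v) = σ g (π v))
    (hs : Function.Surjective π) {δ : FreeGroup β → Q} (h : δ ∈ derivations t σ) :
    ∃ δ' ∈ derivations t ρ, (fun w => π (δ' w)) = δ := by
  choose s hs using hs
  obtain ⟨δ', h1, h2⟩ := exists_derivation (t := t) ρ fun b => s (δ (FreeGroup.of b))
  exact ⟨δ', h1, derivation_ext (derivation_map he h1) h fun b => by rw [h2, hs]⟩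

variable {G' : Type} [Group G'] {ι : G' →* G} {θ : G' →* MulAut (FreeGroup β)}

/-- The action on functions from the free group by conjugation. -/
def conjRep (ι : G' →* G) (θ : G' →* MulAut (FreeGroup β)) {N : Type} [AddCommGroup N]
    (ρ : Representation ℤ G N) : Representation ℤ G' (FreeGroup β → N) where
  toFun g := { toFun := fun δ w => ρ (ι g) (δ (θ g⁻¹ w)), map_add' := by intros; ext; simp,
               map_smul' := by intros; ext; simp }
  map_one' := by ext f x; simp
  map_mul' g h := by ext f x; simp

@[simp] theorem conjRep_apply {N : Type} [AddCommGroup N]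
    (ρ : Representation ℤ G N) (g : G') (δ : FreeGroup β → N) (w : FreeGroup β) :
    conjRep ι θ ρ g δ w = ρ (ι g) (δ (θ g⁻¹ w)) := rfl

theorem conjRep_mem (hconj : ∀ g w, ι g * t w * (ι g)⁻¹ = t (θ g w)) {N : Type} [AddCommGroup N]
    {ρ : Representation ℤ G N} (g : G') (δ : FreeGroup β → N) (h : δ ∈ derivations t ρ) :
    conjRep ι θ ρ g δ ∈ derivations t ρ := by
  intro w w'
  simp only [conjRep_apply, map_mul, h (θ g⁻¹ w), map_add, ← Module.End.mul_apply, ← hconj]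
  simp only [← map_mul]
  simp

/-- Principal derivations. -/
def principal (t : FreeGroup β →* G) {N : Type} [AddCommGroup N] (ρ : Representation ℤ G N) :
    N →+ (FreeGroup β → N) :=
  AddMonoidHom.mk' (fun n w => ρ (t w) n - n) (by
    intro n m
    ext w
    simp only [map_add, Pi.add_apply]
    abel)

@[simp] theorem principal_apply {N : Type} [AddCommGroup N] (ρ : Representation ℤ G N) (n : N)
    (w : FreeGroup β) : principal t ρ n w = ρ (t w) n - n := rfl

theorem principal_mem {N : Type} [AddCommGroup N] (ρ : Representation ℤ G N) (n : N) :
    principal t ρ n ∈ derivations t ρ := by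
  intro w w'
  simp

theorem principal_equivariant (hconj : ∀ g w, ι g * t w * (ι g)⁻¹ = t (θ g w)) {N : Type}
    [AddCommGroup N] (ρ : Representation ℤ G N) (g : G') (n : N) :
    principal t ρ (ρ (ι g) n) = conjRep ι θ ρ g (principal t ρ n) := by
  ext w
  simp only [principal_apply, conjRep_apply, map_sub, ← hconj, ← Module.End.mul_apply]
  simp only [← map_mul]
  simp

theorem cobd_conjRep_map {N Q : Type} [AddCommGroup N] [AddCommGroup Q]
    {ρ : Representation ℤ G N}
    {σ : Representation ℤ G Q} {π : N →+ Q} (he : ∀ g v, π (ρ g v) = σ g (π v)) (k : ℕ)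
    (f : (Fin k → G') → (FreeGroup β → N)) :
    cobd (conjRep ι θ σ) k (fun g w => π (f g w)) = fun g w => π (cobd (conjRep ι θ ρ) k f g w) :=
  cobd_map (conjRep ι θ ρ) (conjRep ι θ σ) (postcomp (FreeGroup β) π)
    (fun g v => by ext w; exact he _ _) k f

/-- Being the coboundary of a cochain with values in derivations. -/
def IsDerCobd (t : FreeGroup β →* G) (ι : G' →* G) (θ : G' →* MulAut (FreeGroup β)) {N : Type}
    [AddCommGroup N] (ρ : Representation ℤ G N) :
    (k : ℕ) → ((Fin k → G') → (FreeGroup β → N)) → Prop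
  | 0, c => c = 0
  | k + 1, c => ∃ e, (∀ g, e g ∈ derivations t ρ) ∧ cobd (conjRep ι θ ρ) k e = c

theorem isDerCobd_of_map_eq_zero {N Q : Type} [AddCommGroup N] [AddCommGroup Q]
    {ρ : Representation ℤ G N} {π : (G → N) →+ Q}
    (hπ : ∀ v, π v = 0 ↔ ∃ w, orbitMap ρ w = v) {k : ℕ}
    {f : (Fin (k + 1) → G') → (FreeGroup β → N)} {b : (Fin k → G') → (FreeGroup β → (G → N))}
    (hb : ∀ g, b g ∈ derivations t (funRep G N))
    (hbf : cobd (conjRep ι θ (funRep G N)) k b = fun g w => orbitMap ρ (f g w))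
    (h0 : ∀ g w, π (b g w) = 0) : IsDerCobd t ι θ ρ (k + 1) f := by
  have h1 : ∀ g w, ∃ n, orbitMap ρ n = b g w := fun g w => (hπ _).1 (h0 g w)
  choose e he using h1
  refine ⟨e, fun g w w' => orbitMap_injective ρ ?_, ?_⟩
  · rw [he, hb, map_add, orbitMap_equivariant, he, he]
  · ext g x
    apply orbitMap_injective ρ
    rw [← congrFun (congrFun (cobd_conjRep_map (orbitMap_equivariant ρ) k e) g) x]
    simp only [he]
    exact congrFun (congrFun hbf g) x

/-- The map from the cohomology of `G` to the cohomology of `G'` with coefficients in derivations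
that is induced by principal derivations is zero. -/
theorem isDerCobd_principal (hconj : ∀ g w, ι g * t w * (ι g)⁻¹ = t (θ g w)) (k : ℕ) :
    ∀ {N : Type} [AddCommGroup N] (ρ : Representation ℤ G N) (c : (Fin k → G) → N),
      cobd ρ k c = 0 → IsDerCobd t ι θ ρ k (fun g => principal t ρ (c (ι ∘ g))) := by
  induction k with
  | zero =>
    intro N _ ρ c hc
    ext g w
    have := congrFun hc fun _ => t w
    rw [cobd_zero_apply] at this
    rw [Subsingleton.elim (ι ∘ g) default]
    exact this
  | succ k ih =>
    intro N _ ρ c hc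
    obtain ⟨Q, iQ, τ, π, hs, he, hk⟩ := exists_shift ρ
    have hπi : ∀ w, π (orbitMap ρ w) = 0 := fun w => (hk _).2 ⟨w, rfl⟩
    let b : (Fin k → G) → (G → N) := fun g x => orbitMap ρ (c (Fin.cons x g)) 1
    have hb : cobd (funRep G N) k b = fun g => orbitMap ρ (c g) :=
      cobd_funRep_homotopy k (fun g => orbitMap ρ (c g)) (by
        rw [cobd_map ρ (funRep G N) (orbitMap ρ) (orbitMap_equivariant ρ), hc]
        ext; simp)
    have hpb : cobd (conjRep ι θ (funRep G N)) k
        (fun g => principal t (funRep G N) (b (ι ∘ g))) =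
        fun g w => orbitMap ρ (principal t ρ (c (ι ∘ g)) w) := by
      rw [cobd_comp (funRep G N) (conjRep ι θ (funRep G N)) ι (principal t (funRep G N))
        (principal_equivariant hconj (funRep G N)), hb]
      ext g w : 2
      simp [orbitMap_equivariant]
    have hih := ih τ (fun g => π (b g)) (by
      rw [cobd_map (funRep G N) τ π he, hb]
      ext g
      exact hπi _)
    have hpp : ∀ g w, principal t τ (π (b g)) w = π (principal t (funRep G N) (b g) w) := by
      intro g w
      simp [he]
    cases k with
    | zero =>
      refine isDerCobd_of_map_eq_zero hk (fun g => principal_mem _ _) hpb fun g w => ?_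
      rw [← hpp]
      exact congrFun (congrFun hih g) w
    | succ k =>
      obtain ⟨h, hd, hh⟩ := hih
      choose h' hd' hh' using fun g => exists_derivation_lift he hs (hd g)
      refine isDerCobd_of_map_eq_zero
        (b := (fun g => principal t (funRep G N) (b (ι ∘ g))) - cobd _ k h') hk
        (fun g => sub_mem (principal_mem _ _) (cobd_mem (conjRep_mem hconj) hd' g))
        (by rw [map_sub, cobd_cobd, sub_zero, hpb]) ?_
      intro g w
      rw [Pi.sub_apply, Pi.sub_apply, map_sub, sub_eq_zero, ← hpp,
        ← congrFun (congrFun (cobd_conjRep_map he k h') g) w]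
      rw [show (fun g w => π (h' g w)) = h from funext hh', hh]

end Derivations

end GroupCochain

namespace FreeForm

open Classical GroupCochain

/-- The additive group of maps `F^j → ℤ` that are homomorphisms in each variable. -/
def Form (j : ℕ) (F : Type) [Group F] : AddSubgroup ((Fin j → F) → ℤ) where
  carrier := {ω | ∀ y l u v, ω (Function.update y l (u * v)) =
    ω (Function.update y l u) + ω (Function.update y l v)}
  add_mem' := by
    intro a b ha hb y l u v
    simp only [Pi.add_apply, ha y l u v, hb y l u v]
    ring
  zero_mem' := by intro y l u v; simp
  neg_mem' := by
    intro a ha y l u v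
    simp only [Pi.neg_apply, ha y l u v]
    ring

section Pullback

variable {F F' F'' : Type} [Group F] [Group F'] [Group F''] {j : ℕ}

theorem Form.update_one (ω : Form j F) (y : Fin j → F) (l : Fin j) :
    ω.1 (Function.update y l 1) = 0 := by
  have := ω.2 y l 1 1
  simpa using this

theorem Form.eq_zero_of_apply_one (ω : Form j F) (y : Fin j → F) (l : Fin j) (h : y l = 1) :
    ω.1 y = 0 := by
  rw [← Function.update_eq_self l y, h, Form.update_one ω]

/-- Pullback of forms along a group homomorphism. -/
def pb (j : ℕ) (φ : F' →* F) : Form j F →+ Form j F' :=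
  AddMonoidHom.mk' (fun ω => ⟨fun y => ω.1 (φ ∘ y), by
    intro y l u v
    simp only [Function.comp_update, map_mul]
    exact ω.2 _ _ _ _⟩) (fun _ _ => rfl)

@[simp] theorem pb_apply (φ : F' →* F) (ω : Form j F) (y : Fin j → F') :
    (pb j φ ω).1 y = ω.1 (φ ∘ y) := rfl

theorem pb_pb (φ : F' →* F) (φ' : F'' →* F') (ω : Form j F) :
    pb j φ' (pb j φ ω) = pb j (φ.comp φ') ω := rfl

theorem pb_id (ω : Form j F) : pb j (MonoidHom.id F) ω = ω := rfl

/-- The action of the automorphism group on all functions of `j` variables. -/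
def rawRep (j : ℕ) (F : Type) [Group F] : Representation ℤ (MulAut F) ((Fin j → F) → ℤ) where
  toFun g := { toFun := fun ω y => ω (⇑(g⁻¹) ∘ y), map_add' := fun _ _ => rfl,
               map_smul' := fun _ _ => rfl }
  map_one' := by ext ω y; rfl
  map_mul' g h := by
    ext ω y
    simp only [mul_inv_rev]
    rfl

/-- The action of the automorphism group on forms. -/
def formRep (j : ℕ) (F : Type) [Group F] : Representation ℤ (MulAut F) (Form j F) where
  toFun g := (pb j (g⁻¹).toMonoidHom).toIntLinearMap
  map_one' := by ext ω y; rfl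
  map_mul' g h := by
    ext ω y
    simp only [mul_inv_rev]
    rfl

theorem formRep_eq (g : MulAut F) (ω : Form j F) :
    formRep j F g ω = pb j (g⁻¹).toMonoidHom ω := rfl

theorem formRep_apply (g : MulAut F) (ω : Form j F) (y : Fin j → F) :
    (formRep j F g ω).1 y = ω.1 (⇑(g⁻¹) ∘ y) := rfl

theorem rawRep_apply (g : MulAut F) (ω : (Fin j → F) → ℤ) (y : Fin j → F) :
    rawRep j F g ω y = ω (⇑(g⁻¹) ∘ y) := rfl

theorem cobd_formRep_val (k : ℕ) (f : (Fin k → MulAut F) → Form j F) :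
    cobd (rawRep j F) k (fun g => (f g).1) = fun g => (cobd (formRep j F) k f g).1 :=
  cobd_map (formRep j F) (rawRep j F) (Form j F).subtype (fun _ _ => rfl) k f

end Pullback

section Coefficients

variable {α : Type} {j : ℕ}

theorem form_ext {ω ω' : Form j (FreeGroup α)}
    (h : ∀ a : Fin j → α, ω.1 (FreeGroup.of ∘ a) = ω'.1 (FreeGroup.of ∘ a)) : ω = ω' := by
  have key : ∀ S : Finset (Fin j), ∀ y : Fin j → FreeGroup α,
      (∀ l ∉ S, ∃ a, y l = FreeGroup.of a) → ω.1 y = ω'.1 y := by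
    intro S
    induction S using Finset.induction_on with
    | empty =>
      intro y hy
      choose a ha using fun l => hy l (Finset.notMem_empty l)
      rw [show y = FreeGroup.of ∘ a from funext ha]
      exact h a
    | insert l S hl ih =>
      intro y hy
      let D (η : Form j (FreeGroup α)) : FreeGroup α →* Multiplicative ℤ :=
        MonoidHom.mk' (fun u => Multiplicative.ofAdd (η.1 (Function.update y l u)))
          (fun u v => by rw [η.2]; rfl)
      have hD : D ω = D ω' := by
        refine FreeGroup.ext_hom _ _ fun a => ?_
        refine congrArg Multiplicative.ofAdd (ih _ fun m hm => ?_)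
        by_cases hml : m = l
        · exact ⟨a, by rw [hml, Function.update_self]⟩
        · rw [Function.update_of_ne hml]
          exact hy m (by simp [hml, hm])
      have := congrArg Multiplicative.toAdd (DFunLike.congr_fun hD (y l))
      simpa [D] using this
  ext y
  exact key Finset.univ y (by simp)

/-- The exponent sum of a generator. -/
def expSum (i : α) : FreeGroup α →* Multiplicative ℤ :=
  FreeGroup.lift fun k => Multiplicative.ofAdd (if k = i then 1 else 0)

theorem exists_form [Fintype α] (c : (Fin j → α) → ℤ) :
    ∃ ω : Form j (FreeGroup α), ∀ a, ω.1 (FreeGroup.of ∘ a) = c a := by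
  refine ⟨⟨fun y => ∑ a, c a * ∏ l, Multiplicative.toAdd (expSum (a l) (y l)), ?_⟩, ?_⟩
  · intro y l u v
    simp only
    rw [← Finset.sum_add_distrib]
    refine Finset.sum_congr rfl fun a _ => ?_
    rw [← mul_add]
    congr 1
    have key : ∀ w, ∏ m, Multiplicative.toAdd (expSum (a m) (Function.update y l w m)) =
        Multiplicative.toAdd (expSum (a l) w) *
          ∏ m ∈ Finset.univ.erase l, Multiplicative.toAdd (expSum (a m) (y m)) := by
      intro w
      rw [← Finset.mul_prod_erase _ _ (Finset.mem_univ l), Function.update_self]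
      congr 1
      refine Finset.prod_congr rfl fun m hm => ?_
      rw [Function.update_of_ne (Finset.ne_of_mem_erase hm)]
    rw [key, key, key, map_mul, toAdd_mul, add_mul]
  · intro a
    simp only
    rw [Finset.sum_eq_single a]
    · simp [expSum]
    · intro b _ hb
      obtain ⟨l, hl⟩ := Function.ne_iff.1 hb
      rw [Finset.prod_eq_zero (Finset.mem_univ l), mul_zero]
      simp [expSum, Ne.symm hl]
    · simp

end Coefficients

section Extension

variable {α : Type} (s : Set α)

/-- The inclusion of the free factor spanned by the generators outside `s`. -/
def inc : FreeGroup {i // i ∉ s} →* FreeGroup α := FreeGroup.map Subtype.val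

/-- The retraction to the free factor spanned by the generators outside `s`. -/
def ret : FreeGroup α →* FreeGroup {i // i ∉ s} :=
  FreeGroup.lift fun a => if h : a ∉ s then FreeGroup.of ⟨a, h⟩ else 1

/-- The endomorphism that sends the generators in `s` to `1` and fixes the other ones. -/
def kill : FreeGroup α →* FreeGroup α :=
  FreeGroup.lift fun a => if a ∈ s then 1 else FreeGroup.of a

variable {s}

@[simp] theorem inc_of (a : {i // i ∉ s}) : inc s (FreeGroup.of a) = FreeGroup.of a.1 := by
  simp [inc]

theorem ret_of_notMem {a : α} (h : a ∉ s) : ret s (FreeGroup.of a) = FreeGroup.of ⟨a, h⟩ := by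
  simp [ret, h]

theorem ret_of_mem {a : α} (h : a ∈ s) : ret s (FreeGroup.of a) = 1 := by
  simp [ret, h]

theorem kill_of_notMem {a : α} (h : a ∉ s) : kill s (FreeGroup.of a) = FreeGroup.of a := by
  simp [kill, h]

theorem kill_of_mem {a : α} (h : a ∈ s) : kill s (FreeGroup.of a) = 1 := by
  simp [kill, h]

theorem ret_comp_inc : (ret s).comp (inc s) = MonoidHom.id _ := by
  refine FreeGroup.ext_hom _ _ fun a => ?_
  simp [ret_of_notMem a.2]

@[simp] theorem ret_inc (w : FreeGroup {i // i ∉ s}) : ret s (inc s w) = w :=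
  DFunLike.congr_fun ret_comp_inc w

theorem inc_comp_ret : (inc s).comp (ret s) = kill s := by
  refine FreeGroup.ext_hom _ _ fun a => ?_
  by_cases h : a ∈ s
  · simp [ret_of_mem h, kill_of_mem h]
  · simp [ret_of_notMem h, kill_of_notMem h]

theorem inc_ret (w : FreeGroup α) : inc s (ret s w) = kill s w :=
  DFunLike.congr_fun inc_comp_ret w

theorem kill_comp_kill {s' : Set α} (h : s' ⊆ s) : (kill s').comp (kill s) = kill s := by
  refine FreeGroup.ext_hom _ _ fun a => ?_
  by_cases ha : a ∈ s
  · simp [kill_of_mem ha]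
  · simp [kill_of_notMem ha, kill_of_notMem fun h' => ha (h h')]

variable (s) in
/-- Extension of an endomorphism by the identity on the generators in `s`. -/
def extHom (φ : FreeGroup {i // i ∉ s} →* FreeGroup {i // i ∉ s}) :
    FreeGroup α →* FreeGroup α :=
  FreeGroup.lift fun a => if h : a ∉ s then inc s (φ (FreeGroup.of ⟨a, h⟩)) else FreeGroup.of a

theorem extHom_of_mem (φ : FreeGroup {i // i ∉ s} →* FreeGroup {i // i ∉ s}) {a : α}
    (h : a ∈ s) : extHom s φ (FreeGroup.of a) = FreeGroup.of a := by
  simp [extHom, h]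

theorem extHom_comp_inc (φ : FreeGroup {i // i ∉ s} →* FreeGroup {i // i ∉ s}) :
    (extHom s φ).comp (inc s) = (inc s).comp φ := by
  refine FreeGroup.ext_hom _ _ fun a => ?_
  simp [extHom, a.2]

theorem extHom_inc (φ : FreeGroup {i // i ∉ s} →* FreeGroup {i // i ∉ s})
    (w : FreeGroup {i // i ∉ s}) : extHom s φ (inc s w) = inc s (φ w) :=
  DFunLike.congr_fun (extHom_comp_inc φ) w

theorem hom_ext_inc {M : Type} [Group M] {f g : FreeGroup α →* M}
    (h1 : ∀ a ∈ s, f (FreeGroup.of a) = g (FreeGroup.of a))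
    (h2 : ∀ w, f (inc s w) = g (inc s w)) : f = g := by
  refine FreeGroup.ext_hom _ _ fun a => ?_
  by_cases h : a ∈ s
  · exact h1 a h
  · simpa using h2 (FreeGroup.of ⟨a, h⟩)

theorem extHom_comp (φ ψ : FreeGroup {i // i ∉ s} →* FreeGroup {i // i ∉ s}) :
    extHom s (φ.comp ψ) = (extHom s φ).comp (extHom s ψ) := by
  refine hom_ext_inc (s := s) (fun a ha => ?_) fun w => ?_
  · simp [extHom_of_mem _ ha]
  · simp [extHom_inc]

theorem extHom_id : extHom s (MonoidHom.id _) = MonoidHom.id _ := by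
  refine hom_ext_inc (s := s) (fun a ha => ?_) fun w => ?_
  · simp [extHom_of_mem _ ha]
  · simp [extHom_inc]

variable (s) in
/-- Extension of automorphisms by the identity on the generators in `s`. -/
def extAut : MulAut (FreeGroup {i // i ∉ s}) →* MulAut (FreeGroup α) where
  toFun ψ := MonoidHom.toMulEquiv (extHom s ψ.toMonoidHom) (extHom s (ψ⁻¹).toMonoidHom)
    (by rw [← extHom_comp, ← extHom_id]; congr 1; ext; simp)
    (by rw [← extHom_comp, ← extHom_id]; congr 1; ext; simp)
  map_one' := by
    ext w
    exact DFunLike.congr_fun extHom_id w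
  map_mul' φ ψ := by
    ext w
    exact DFunLike.congr_fun (extHom_comp φ.toMonoidHom ψ.toMonoidHom) w

theorem extAut_of_mem (ψ : MulAut (FreeGroup {i // i ∉ s})) {a : α}
    (h : a ∈ s) : extAut s ψ (FreeGroup.of a) = FreeGroup.of a :=
  extHom_of_mem _ h

theorem extAut_inc (ψ : MulAut (FreeGroup {i // i ∉ s}))
    (w : FreeGroup {i // i ∉ s}) : extAut s ψ (inc s w) = inc s (ψ w) :=
  extHom_inc _ w

theorem ret_extAut (ψ : MulAut (FreeGroup {i // i ∉ s})) (w : FreeGroup α) :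
    ret s (extAut s ψ w) = ψ (ret s w) := by
  have : (ret s).comp (extAut s ψ).toMonoidHom = ψ.toMonoidHom.comp (ret s) := by
    refine hom_ext_inc (s := s) (fun a ha => ?_) fun w => ?_
    · simp [extAut_of_mem ψ ha, ret_of_mem ha]
    · simp [extAut_inc]
  exact DFunLike.congr_fun this w

theorem extAut_injective : Function.Injective (extAut s) := by
  intro φ ψ h
  ext w
  have := congrArg (ret s) (DFunLike.congr_fun h (inc s w))
  simpa [extAut_inc] using this

variable (s) in
/-- The automorphisms fixing the generators in `s` and preserving the free factor spanned by the
other ones. -/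
def stab : Subgroup (MulAut (FreeGroup α)) where
  carrier := {ψ | (∀ i ∈ s, ψ (FreeGroup.of i) = FreeGroup.of i) ∧
    ∀ w, ψ (kill s w) = kill s (ψ w)}
  mul_mem' := by
    rintro φ ψ ⟨h1, h2⟩ ⟨h3, h4⟩
    exact ⟨fun i hi => by rw [MulAut.mul_apply, h3 i hi, h1 i hi],
      fun w => by rw [MulAut.mul_apply, h4, h2, MulAut.mul_apply]⟩
  one_mem' := ⟨fun _ _ => rfl, fun _ => rfl⟩
  inv_mem' := by
    rintro φ ⟨h1, h2⟩
    refine ⟨fun i hi => ?_, fun w => ?_⟩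
    · rw [MulAut.inv_apply, MulEquiv.symm_apply_eq, h1 i hi]
    · rw [MulAut.inv_apply, MulEquiv.symm_apply_eq, h2]
      simp

theorem extAut_mem_stab (ψ : MulAut (FreeGroup {i // i ∉ s})) : extAut s ψ ∈ stab s :=
  ⟨fun _ hi => extAut_of_mem ψ hi, fun w => by
    rw [← inc_ret, ← inc_ret, extAut_inc, ret_extAut]⟩

theorem exists_extAut_of_mem_stab {ψ : MulAut (FreeGroup α)} (h : ψ ∈ stab s) :
    ∃ φ, extAut s φ = ψ := by
  have key : ∀ {ψ : MulAut (FreeGroup α)}, ψ ∈ stab s → ∀ w, inc s (ret s (ψ (inc s w))) =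
      ψ (inc s w) := by
    intro ψ h w
    rw [inc_ret, ← h.2, ← inc_ret, ret_inc]
  have h1 : ((ret s).comp ((ψ⁻¹).toMonoidHom.comp (inc s))).comp
      ((ret s).comp (ψ.toMonoidHom.comp (inc s))) = MonoidHom.id _ := by
    ext w
    have := key h (FreeGroup.of w)
    simp only [inc_of] at this
    simp [this, ret_of_notMem w.2]
  have h2 : ((ret s).comp (ψ.toMonoidHom.comp (inc s))).comp
      ((ret s).comp ((ψ⁻¹).toMonoidHom.comp (inc s))) = MonoidHom.id _ := by
    ext w
    have := key (inv_mem h) (FreeGroup.of w)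
    simp only [inc_of, MulAut.inv_apply] at this
    simp [this, ret_of_notMem w.2]
  refine ⟨MonoidHom.toMulEquiv _ _ h1 h2, ?_⟩
  have : (extAut s (MonoidHom.toMulEquiv _ _ h1 h2)).toMonoidHom = ψ.toMonoidHom := by
    refine hom_ext_inc (s := s) (fun a ha => ?_) fun w => ?_
    · change extAut s _ (FreeGroup.of a) = ψ (FreeGroup.of a)
      rw [extAut_of_mem _ ha, h.1 a ha]
    · change extAut s _ (inc s w) = ψ (inc s w)
      rw [extAut_inc]
      exact key h w
  ext w
  exact DFunLike.congr_fun this w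

theorem stab_anti {s' : Set α} (h : s' ⊆ s) : stab s ≤ stab s' := by
  rintro ψ ⟨h1, h2⟩
  refine ⟨fun i hi => h1 i (h hi), fun w => ?_⟩
  have : ψ.toMonoidHom.comp (kill s') = (kill s').comp ψ.toMonoidHom := by
    refine FreeGroup.ext_hom _ _ fun a => ?_
    simp only [MonoidHom.comp_apply, MulEquiv.coe_toMonoidHom]
    by_cases ha' : a ∈ s'
    · rw [h1 a (h ha'), kill_of_mem ha', map_one]
    · rw [kill_of_notMem ha']
      by_cases ha : a ∈ s
      · rw [h1 a ha, kill_of_notMem ha']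
      · have := h2 (FreeGroup.of a)
        rw [kill_of_notMem ha] at this
        rw [this]
        exact (DFunLike.congr_fun (kill_comp_kill h) _).symm
  exact DFunLike.congr_fun this w

end Extension

end FreeForm

namespace FreeForm

open Classical GroupCochain

section Transvection

variable {α : Type} {s : Set α} {x : α}

/-- The endomorphism multiplying the generator `x` on the right by a word avoiding `s`. -/
def transvectHom (s : Set α) (x : α) (w : FreeGroup {i // i ∉ s}) :
    FreeGroup α →* FreeGroup α :=
  FreeGroup.lift fun a => if a = x then FreeGroup.of x * inc s w else FreeGroup.of a

theorem transvectHom_self (w : FreeGroup {i // i ∉ s}) :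
    transvectHom s x w (FreeGroup.of x) = FreeGroup.of x * inc s w := by
  simp [transvectHom]

theorem transvectHom_of_ne (w : FreeGroup {i // i ∉ s}) {a : α} (h : a ≠ x) :
    transvectHom s x w (FreeGroup.of a) = FreeGroup.of a := by
  simp [transvectHom, h]

theorem transvectHom_inc (hx : x ∈ s) (w v : FreeGroup {i // i ∉ s}) :
    transvectHom s x w (inc s v) = inc s v := by
  have : (transvectHom s x w).comp (inc s) = inc s := by
    refine FreeGroup.ext_hom _ _ fun a => ?_
    simp only [MonoidHom.comp_apply, inc_of]
    exact transvectHom_of_ne w fun h => a.2 (h ▸ hx)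
  exact DFunLike.congr_fun this v

theorem transvectHom_mul (hx : x ∈ s) (w v : FreeGroup {i // i ∉ s}) :
    transvectHom s x (w * v) = (transvectHom s x w).comp (transvectHom s x v) := by
  refine FreeGroup.ext_hom _ _ fun a => ?_
  by_cases h : a = x
  · subst h
    simp [transvectHom_self, transvectHom_inc hx, mul_assoc]
  · simp [transvectHom_of_ne _ h]

theorem transvectHom_one : transvectHom s x 1 = MonoidHom.id _ := by
  refine FreeGroup.ext_hom _ _ fun a => ?_
  by_cases h : a = x
  · subst h
    simp [transvectHom_self]
  · simp [transvectHom_of_ne _ h]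

/-- The automorphisms multiplying the generator `x` on the right by a word avoiding `s`. -/
def transvect (hx : x ∈ s) : FreeGroup {i // i ∉ s} →* MulAut (FreeGroup α) where
  toFun w := MonoidHom.toMulEquiv (transvectHom s x w) (transvectHom s x w⁻¹)
    (by rw [← transvectHom_mul hx, inv_mul_cancel, transvectHom_one])
    (by rw [← transvectHom_mul hx, mul_inv_cancel, transvectHom_one])
  map_one' := by
    ext w
    exact DFunLike.congr_fun transvectHom_one w
  map_mul' v w := by
    ext u
    exact DFunLike.congr_fun (transvectHom_mul hx v w) u

theorem transvect_self (hx : x ∈ s) (w : FreeGroup {i // i ∉ s}) :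
    transvect hx w (FreeGroup.of x) = FreeGroup.of x * inc s w :=
  transvectHom_self w

theorem transvect_of_ne (hx : x ∈ s) (w : FreeGroup {i // i ∉ s}) {a : α} (h : a ≠ x) :
    transvect hx w (FreeGroup.of a) = FreeGroup.of a :=
  transvectHom_of_ne w h

theorem transvect_inc (hx : x ∈ s) (w v : FreeGroup {i // i ∉ s}) :
    transvect hx w (inc s v) = inc s v :=
  transvectHom_inc hx w v

theorem transvect_conj (hx : x ∈ s) (g : MulAut (FreeGroup {i // i ∉ s}))
    (w : FreeGroup {i // i ∉ s}) :
    extAut s g * transvect hx w * (extAut s g)⁻¹ = transvect hx (g w) := by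
  rw [mul_inv_eq_iff_eq_mul]
  have : (extAut s g * transvect hx w).toMonoidHom =
      (transvect hx (g w) * extAut s g).toMonoidHom := by
    refine hom_ext_inc (s := s) (fun a ha => ?_) fun v => ?_
    · simp only [MulEquiv.coe_toMonoidHom, MulAut.mul_apply, extAut_of_mem g ha]
      by_cases h : a = x
      · subst h
        rw [transvect_self, transvect_self, map_mul, extAut_of_mem g ha, extAut_inc]
      · rw [transvect_of_ne hx _ h, transvect_of_ne hx _ h, extAut_of_mem g ha]
    · simp only [MulEquiv.coe_toMonoidHom, MulAut.mul_apply, extAut_inc, transvect_inc]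
  ext v
  exact DFunLike.congr_fun this v

end Transvection

section Restriction

variable {α : Type} {s : Set α} {x : α} {j : ℕ}

/-- Evaluation of a form-valued function, its argument becoming the first variable of a form. -/
def evalInc (s : Set α) (j : ℕ) :
    (FreeGroup {i // i ∉ s} → Form j (FreeGroup α)) →+
      ((Fin (j + 1) → FreeGroup {i // i ∉ s}) → ℤ) :=
  AddMonoidHom.mk' (fun δ z => (δ (z 0)).1 (inc s ∘ Fin.tail z)) (fun _ _ => rfl)

/-- Evaluation of a form-valued function at the generator `x` in the first variable. -/
def evalGen (s : Set α) (x : α) (j : ℕ) :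
    (FreeGroup {i // i ∉ s} → Form (j + 1) (FreeGroup α)) →+
      ((Fin (j + 1) → FreeGroup {i // i ∉ s}) → ℤ) :=
  AddMonoidHom.mk' (fun δ z => (δ (z 0)).1 (Fin.cons (FreeGroup.of x) (inc s ∘ Fin.tail z)))
    (fun _ _ => rfl)

theorem evalInc_apply (δ : FreeGroup {i // i ∉ s} → Form j (FreeGroup α))
    (z : Fin (j + 1) → FreeGroup {i // i ∉ s}) :
    evalInc s j δ z = (δ (z 0)).1 (inc s ∘ Fin.tail z) := rfl

theorem evalGen_apply (δ : FreeGroup {i // i ∉ s} → Form (j + 1) (FreeGroup α))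
    (z : Fin (j + 1) → FreeGroup {i // i ∉ s}) :
    evalGen s x j δ z = (δ (z 0)).1 (Fin.cons (FreeGroup.of x) (inc s ∘ Fin.tail z)) := rfl

theorem inv_comp_inc (g : MulAut (FreeGroup {i // i ∉ s})) {m : ℕ}
    (y : Fin m → FreeGroup {i // i ∉ s}) :
    ⇑((extAut s g)⁻¹) ∘ (inc s ∘ y) = inc s ∘ (⇑(g⁻¹) ∘ y) := by
  ext l
  simp only [Function.comp_apply, ← map_inv, extAut_inc]

theorem comp_tail {A B : Type} {m : ℕ} (f : A → B) (z : Fin (m + 1) → A) :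
    Fin.tail (f ∘ z) = f ∘ Fin.tail z := rfl

theorem evalInc_equivariant (g : MulAut (FreeGroup {i // i ∉ s}))
    (δ : FreeGroup {i // i ∉ s} → Form j (FreeGroup α)) :
    evalInc s j (conjRep (extAut s) (MonoidHom.id _) (formRep j (FreeGroup α)) g δ) =
      rawRep (j + 1) _ g (evalInc s j δ) := by
  ext z
  simp only [rawRep_apply, evalInc_apply, conjRep_apply, formRep_apply, inv_comp_inc, comp_tail]
  rfl

theorem evalGen_equivariant (hx : x ∈ s) (g : MulAut (FreeGroup {i // i ∉ s}))
    (δ : FreeGroup {i // i ∉ s} → Form (j + 1) (FreeGroup α)) :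
    evalGen s x j (conjRep (extAut s) (MonoidHom.id _) (formRep (j + 1) (FreeGroup α)) g δ) =
      rawRep (j + 1) _ g (evalGen s x j δ) := by
  ext z
  simp only [rawRep_apply, evalGen_apply, conjRep_apply, formRep_apply, comp_tail, Fin.comp_cons,
    inv_comp_inc]
  rw [← map_inv, extAut_of_mem _ hx]
  rfl

theorem transvect_inv_comp_inc (hx : x ∈ s) (w : FreeGroup {i // i ∉ s}) {m : ℕ}
    (y : Fin m → FreeGroup {i // i ∉ s}) :
    ⇑((transvect hx w)⁻¹) ∘ (inc s ∘ y) = inc s ∘ y := by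
  ext l
  simp only [Function.comp_apply, ← map_inv, transvect_inc]

theorem evalInc_mem (hx : x ∈ s) {δ : FreeGroup {i // i ∉ s} → Form j (FreeGroup α)}
    (h : δ ∈ derivations (transvect hx) (formRep j (FreeGroup α))) :
    evalInc s j δ ∈ Form (j + 1) (FreeGroup {i // i ∉ s}) := by
  intro y l u v
  refine Fin.cases ?_ (fun l => ?_) l
  · simp only [evalInc_apply, Function.update_self, Fin.tail_update_zero]
    rw [h u v, AddSubgroup.coe_add, Pi.add_apply, formRep_apply, transvect_inv_comp_inc]
  · simp only [evalInc_apply, Fin.tail_update_succ, Function.comp_update, map_mul,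
      Function.update_of_ne (Fin.succ_ne_zero l).symm]
    exact (δ (y 0)).2 _ _ _ _

theorem cons_mul_right (ω : Form (j + 1) (FreeGroup α)) (u v : FreeGroup α)
    (y : Fin j → FreeGroup α) :
    ω.1 (Fin.cons (u * v) y) = ω.1 (Fin.cons u y) + ω.1 (Fin.cons v y) := by
  have := ω.2 (Fin.cons 1 y) 0 u v
  simpa using this

theorem transvect_inv_comp_cons (hx : x ∈ s) (w : FreeGroup {i // i ∉ s})
    (ω : Form (j + 1) (FreeGroup α)) (y : Fin j → FreeGroup {i // i ∉ s}) :
    (formRep (j + 1) (FreeGroup α) (transvect hx w) ω).1 (Fin.cons (FreeGroup.of x) (inc s ∘ y)) =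
      ω.1 (Fin.cons (FreeGroup.of x) (inc s ∘ y)) - ω.1 (Fin.cons (inc s w) (inc s ∘ y)) := by
  rw [formRep_apply, Fin.comp_cons, transvect_inv_comp_inc, ← map_inv, transvect_self,
    cons_mul_right, map_inv]
  have := cons_mul_right ω (inc s w)⁻¹ (inc s w) (inc s ∘ y)
  rw [inv_mul_cancel, Form.eq_zero_of_apply_one ω _ 0 rfl] at this
  linarith

theorem evalGen_mem (hx : x ∈ s) {δ : FreeGroup {i // i ∉ s} → Form (j + 1) (FreeGroup α)}
    (h : δ ∈ derivations (transvect hx) (formRep (j + 1) (FreeGroup α)))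
    (h0 : evalInc s (j + 1) δ = 0) :
    evalGen s x j δ ∈ Form (j + 1) (FreeGroup {i // i ∉ s}) := by
  intro y l u v
  refine Fin.cases ?_ (fun l => ?_) l
  · simp only [evalGen_apply, Function.update_self, Fin.tail_update_zero]
    rw [h u v, AddSubgroup.coe_add, Pi.add_apply, transvect_inv_comp_cons]
    have := congrFun h0 (Fin.cons v (Fin.cons u (Fin.tail y)))
    rw [evalInc_apply, Fin.tail_cons, Fin.cons_zero, Fin.comp_cons, Pi.zero_apply] at this
    rw [this, sub_zero]
  · have key : ∀ w, evalGen s x j δ (Function.update y l.succ w) =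
        (δ (y 0)).1 (Function.update
          (Fin.cons (FreeGroup.of x) (inc s ∘ Fin.tail y) : Fin (j + 1) → FreeGroup α)
          l.succ (inc s w)) := by
      intro w
      rw [evalGen_apply, Fin.tail_update_succ, Function.comp_update,
        Function.update_of_ne (Fin.succ_ne_zero l).symm, Fin.cons_update]
    rw [key, key, key, map_mul]
    exact (δ (y 0)).2 _ _ _ _

theorem evalGen_principal (hx : x ∈ s) (ω : Form (j + 1) (FreeGroup α)) :
    evalGen s x j (principal (transvect hx) (formRep (j + 1) (FreeGroup α)) ω) =
      -(pb (j + 1) (inc s) ω).1 := by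
  ext z
  rw [evalGen_apply, principal_apply, AddSubgroup.coe_sub, Pi.sub_apply, transvect_inv_comp_cons,
    Pi.neg_apply, pb_apply]
  conv_rhs => rw [← Fin.cons_self_tail z, Fin.comp_cons]
  ring

theorem evalInc_principal (hx : x ∈ s) (ω : Form j (FreeGroup α)) :
    evalInc s j (principal (transvect hx) (formRep j (FreeGroup α)) ω) = 0 := by
  ext z
  rw [evalInc_apply, principal_apply, AddSubgroup.coe_sub, Pi.sub_apply, formRep_apply,
    transvect_inv_comp_inc, sub_self]
  rfl

/-- Fixing the first variable of a form. -/
def curryForm (ω : Form (j + 1) (FreeGroup α)) (u : FreeGroup α) : Form j (FreeGroup α) :=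
  ⟨fun y => ω.1 (Fin.cons u y), by
    intro y l v w
    simp only [Fin.cons_update]
    exact ω.2 _ _ _ _⟩

theorem exists_evalInc_eq (hx : x ∈ s) (ω : Form (j + 1) (FreeGroup {i // i ∉ s})) :
    ∃ δ ∈ derivations (transvect hx) (formRep j (FreeGroup α)), evalInc s j δ = ω.1 := by
  obtain ⟨δ, h1, h2⟩ := exists_derivation (t := transvect hx) (formRep j (FreeGroup α))
    fun b => pb j (ret s) (curryForm ω (FreeGroup.of b))
  refine ⟨δ, h1, ?_⟩
  have : (⟨evalInc s j δ, evalInc_mem hx h1⟩ : Form (j + 1) (FreeGroup {i // i ∉ s})) = ω := by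
    refine form_ext fun a => ?_
    simp only [evalInc_apply, Function.comp_apply, h2, pb_apply]
    rw [← Function.comp_assoc, ← MonoidHom.coe_comp, ret_comp_inc, MonoidHom.coe_id,
      Function.id_comp]
    change ω.1 (Fin.cons (FreeGroup.of (a 0)) (Fin.tail (FreeGroup.of ∘ a))) = _
    exact congrArg ω.1 (Fin.cons_self_tail (FreeGroup.of ∘ a))
  exact congrArg Subtype.val this

/-- Restriction to a smaller free factor is zero in cohomology. -/
theorem isCobd_restrict (hx : x ∈ s) (k : ℕ)
    (hv : ∀ k', k = k' + 1 → Van (formRep (j + 2) (FreeGroup {i // i ∉ s})) k')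
    (c : (Fin k → MulAut (FreeGroup α)) → Form (j + 1) (FreeGroup α))
    (hc : cobd (formRep (j + 1) (FreeGroup α)) k c = 0) :
    IsCobd (formRep (j + 1) (FreeGroup {i // i ∉ s})) k
      (fun g => pb (j + 1) (inc s) (c (extAut s ∘ g))) := by
  have hconj : ∀ g w, extAut s g * transvect hx w * (extAut s g)⁻¹ =
      transvect hx ((MonoidHom.id (MulAut (FreeGroup {i // i ∉ s})) g) w) :=
    fun g w => transvect_conj hx g w
  have hder := isDerCobd_principal hconj k (formRep (j + 1) (FreeGroup α)) c hc
  cases k with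
  | zero =>
    ext g : 1
    have h := congrFun hder g
    have h' := evalGen_principal hx (c (extAut s ∘ g))
    rw [h] at h'
    apply Subtype.ext
    rw [← neg_inj, ← h']
    exact (map_zero (evalGen s x j)).trans neg_zero.symm
  | succ k =>
    obtain ⟨h, hd, hh⟩ := hder
    suffices hmain : ∃ h' : (Fin k → MulAut (FreeGroup {i // i ∉ s})) →
        (FreeGroup {i // i ∉ s} → Form (j + 1) (FreeGroup α)),
        (∀ g, h' g ∈ derivations (transvect hx) (formRep (j + 1) (FreeGroup α))) ∧
        (∀ g, evalInc s (j + 1) (h' g) = 0) ∧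
        cobd (conjRep (extAut s) (MonoidHom.id _) (formRep (j + 1) (FreeGroup α))) k h' =
          fun g => principal (transvect hx) (formRep (j + 1) (FreeGroup α)) (c (extAut s ∘ g)) by
      obtain ⟨h', hd', h0', hh'⟩ := hmain
      refine ⟨fun g => -⟨evalGen s x j (h' g), evalGen_mem hx (hd' g) (h0' g)⟩, ?_⟩
      ext g : 1
      apply Subtype.ext
      have e1 := congrFun (cobd_map _ (rawRep (j + 1) _) (evalGen s x j)
        (evalGen_equivariant hx) k h') g
      rw [hh', evalGen_principal] at e1
      have e2 := congrFun (cobd_formRep_val k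
        fun g => -(⟨evalGen s x j (h' g), evalGen_mem hx (hd' g) (h0' g)⟩ : Form (j + 1) _)) g
      rw [← e2]
      rw [show (fun g => (-(⟨evalGen s x j (h' g), evalGen_mem hx (hd' g) (h0' g)⟩ :
        Form (j + 1) (FreeGroup {i // i ∉ s}))).1) = -(fun g => evalGen s x j (h' g)) from rfl,
        map_neg, Pi.neg_apply, e1, neg_neg]
    let m : (Fin k → MulAut (FreeGroup {i // i ∉ s})) →
      Form (j + 2) (FreeGroup {i // i ∉ s}) :=
    fun g => ⟨evalInc s (j + 1) (h g), evalInc_mem hx (hd g)⟩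
    have hm : cobd (formRep (j + 2) _) k m = 0 := by
      ext g : 1
      apply Subtype.ext
      rw [← congrFun (cobd_formRep_val k m) g]
      rw [show (fun g => (m g).1) = fun g => evalInc s (j + 1) (h g) from rfl,
        cobd_map _ (rawRep (j + 2) _) (evalInc s (j + 1)) evalInc_equivariant, hh]
      exact evalInc_principal hx _
    have hmc := hv k rfl m hm
    cases k with
    | zero => exact ⟨h, hd, fun g => congrArg Subtype.val (congrFun hmc g), hh⟩
    | succ k =>
      obtain ⟨e, he⟩ := hmc
      choose h3 hd3 he3 using fun g => exists_evalInc_eq hx (e g)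
      refine ⟨h - cobd _ k h3, fun g => sub_mem (hd g) (cobd_mem (conjRep_mem hconj) hd3 g), ?_, ?_⟩
      · intro g
        rw [Pi.sub_apply, map_sub, ← congrFun (cobd_map _ (rawRep (j + 2) _) (evalInc s (j + 1))
          evalInc_equivariant k h3) g, funext he3, cobd_formRep_val, he]
        exact sub_self _
      · rw [map_sub, cobd_cobd, sub_zero, hh]

end Restriction

end FreeForm

namespace TupleComplex

open Classical

variable {α A : Type} [AddCommGroup A]

/-- The simplicial differential on functions of tuples. -/
def face (q : ℕ) : ((Fin q → α) → A) →+ ((Fin (q + 1) → α) → A) :=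
  AddMonoidHom.mk' (fun u s => ∑ k : Fin (q + 1), (-1 : ℤ) ^ (k : ℕ) • u (s ∘ k.succAbove)) (by
    intro u v
    ext s
    simp [Finset.sum_add_distrib])

theorem face_apply (q : ℕ) (u : (Fin q → α) → A) (s : Fin (q + 1) → α) :
    face q u s = ∑ k : Fin (q + 1), (-1 : ℤ) ^ (k : ℕ) • u (s ∘ k.succAbove) := rfl

theorem face_congr {q : ℕ} {u v : (Fin q → α) → A} {s : Fin (q + 1) → α}
    (h : ∀ k : Fin (q + 1), u (s ∘ k.succAbove) = v (s ∘ k.succAbove)) :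
    face q u s = face q v s := by
  rw [face_apply, face_apply]
  exact Finset.sum_congr rfl fun k _ => by rw [h]

theorem face_eq_zero {q : ℕ} {u : (Fin q → α) → A} {s : Fin (q + 1) → α}
    (h : ∀ k : Fin (q + 1), u (s ∘ k.succAbove) = 0) : face q u s = 0 := by
  rw [face_apply]
  exact Finset.sum_eq_zero fun k _ => by rw [h, smul_zero]

theorem map_face {B : Type} [AddCommGroup B] (π : A →+ B) (q : ℕ) (u : (Fin q → α) → A)
    (s : Fin (q + 1) → α) : π (face q u s) = face q (fun t => π (u t)) s := by
  rw [face_apply, face_apply, map_sum]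
  exact Finset.sum_congr rfl fun k _ => by rw [map_zsmul]

theorem face_zero_apply (u : (Fin 0 → α) → A) (s : Fin 1 → α) : face 0 u s = u default := by
  rw [face_apply, Fin.sum_univ_succ, Fin.sum_univ_zero, add_zero,
    Subsingleton.elim (s ∘ (0 : Fin 1).succAbove) default]
  simp

theorem face_cons (q : ℕ) (u : (Fin (q + 1) → α) → A) (v : α) (s : Fin (q + 1) → α) :
    face (q + 1) u (Fin.cons v s) = u s - face q (fun t => u (Fin.cons v t)) s := by
  rw [face_apply, Fin.sum_univ_succ, face_apply, sub_eq_add_neg, ← Finset.sum_neg_distrib]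
  congr 1
  · simp only [Fin.val_zero, pow_zero, one_smul]
    rfl
  · refine Finset.sum_congr rfl fun k _ => ?_
    rw [Fin.val_succ, pow_succ, mul_neg_one, neg_smul]
    congr 3
    ext i
    refine Fin.cases ?_ (fun i => ?_) i <;> simp

theorem face_face (q : ℕ) : ∀ u : (Fin q → α) → A, face (q + 1) (face q u) = 0 := by
  induction q with
  | zero =>
    intro u
    ext s
    rw [← Fin.cons_self_tail s, face_cons, face_zero_apply, face_zero_apply, face_zero_apply,
      sub_self]
    rfl
  | succ q ih =>
    intro u
    ext s
    rw [← Fin.cons_self_tail s, face_cons]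
    have h : (fun t => face (q + 1) u (Fin.cons (s 0) t)) =
        u - face q fun t => u (Fin.cons (s 0) t) := by
      ext t
      exact face_cons q u (s 0) t
    rw [h, map_sub, ih, sub_zero, sub_self]
    rfl

/-- Being the differential, on tuples in `V`, of a function that vanishes on the tuples avoiding a
member of `E`; in degree zero this means that the function vanishes. -/
def IsFace (V : Finset α) (E : Finset (Finset α)) : (q : ℕ) → ((Fin q → α) → ℤ) → Prop
  | 0, f => f default = 0
  | q + 1, f => ∃ e : (Fin q → α) → ℤ, (∀ s, (∀ i, s i ∈ V) → face q e s = f s) ∧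
      ∀ t, (∀ i, t i ∈ V) → ∀ τ ∈ E, (∀ i, t i ∉ τ) → e t = 0

theorem isFace_of_face_eq_zero (E : Finset (Finset α)) (hE : ∀ τ ∈ E, τ.card ≤ 2) :
    ∀ (q : ℕ) (V : Finset α) (_ : 2 * q + 1 ≤ V.card) (f : (Fin q → α) → ℤ)
      (_ : ∀ s, (∀ i, s i ∈ V) → face q f s = 0)
      (_ : ∀ t, (∀ i, t i ∈ V) → ∀ τ ∈ E, (∀ i, t i ∉ τ) → f t = 0), IsFace V E q f := by
  induction E using Finset.induction_on with
  | empty =>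
    intro q V hV f hf _
    obtain ⟨v, hv⟩ : V.Nonempty := Finset.card_pos.1 (by omega)
    cases q with
    | zero => simpa [IsFace, face_zero_apply] using hf (fun _ => v) fun _ => hv
    | succ q =>
      refine ⟨fun t => f (Fin.cons v t), fun s hs => ?_, by simp⟩
      have := hf (Fin.cons v s) fun i => Fin.cases hv hs i
      rw [face_cons, sub_eq_zero] at this
      exact this.symm
  | insert τ E _ ih =>
    intro q V hV f hf hs
    replace ih := ih fun σ hσ => hE σ (Finset.mem_insert_of_mem hσ)
    cases q with
    | zero =>
      obtain ⟨v, hv⟩ : V.Nonempty := Finset.card_pos.1 (by omega)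
      simpa [IsFace, face_zero_apply] using hf (fun _ => v) fun _ => hv
    | succ q =>
      obtain ⟨e, he, hes⟩ := ih (q + 1) V hV f hf fun t ht σ hσ =>
        hs t ht σ (Finset.mem_insert_of_mem hσ)
      have hcard : 2 * q + 1 ≤ (V \ τ).card := by
        have h1 := Finset.le_card_sdiff τ V
        have h2 := hE τ (Finset.mem_insert_self _ _)
        omega
      have hmem : ∀ {m : ℕ} {t : Fin m → α}, (∀ i, t i ∈ V \ τ) ↔
          (∀ i, t i ∈ V) ∧ ∀ i, t i ∉ τ := by
        intro m t
        simp [Finset.mem_sdiff, forall_and]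
      have key := ih q (V \ τ) hcard e
        (fun s hsV => by
          rw [hmem] at hsV
          rw [he s hsV.1, hs s hsV.1 τ (Finset.mem_insert_self _ _) hsV.2])
        fun t ht => hes t (hmem.1 ht).1
      cases q with
      | zero =>
        exact ⟨e, he, fun t _ _ _ _ => by rw [Subsingleton.elim t default]; exact key⟩
      | succ q =>
        obtain ⟨d, hd, hds⟩ := key
        let d' : (Fin q → α) → ℤ := fun t => if ∀ i, t i ∉ τ then d t else 0
        refine ⟨e - face q d', fun s hsV => ?_, fun t ht σ hσ hta => ?_⟩
        · rw [map_sub, face_face, sub_zero, he s hsV]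
        · rw [Pi.sub_apply, sub_eq_zero]
          rcases Finset.mem_insert.1 hσ with rfl | hσ
          · rw [← hd t (hmem.2 ⟨ht, hta⟩)]
            exact face_congr fun k => (if_pos fun i => hta _).symm
          · rw [hes t ht σ hσ hta, face_eq_zero fun k => ?_]
            by_cases h : ∀ i, (t ∘ k.succAbove) i ∉ τ
            · rw [show d' (t ∘ k.succAbove) = d (t ∘ k.succAbove) from if_pos h]
              exact hds _ (hmem.2 ⟨fun i => ht _, h⟩) σ hσ fun i => hta _
            · exact if_neg h

end TupleComplex

namespace WordOrder

open Classical FreeGroup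

variable {α : Type}

theorem exists_cancel {L₁ L₂ : List (α × Bool)} (h₁ : IsReduced L₁) (h₂ : IsReduced L₂) :
    ∃ a c d, L₁ = a ++ invRev c ∧ L₂ = c ++ d ∧ IsReduced (a ++ d) := by
  induction L₂ generalizing L₁ with
  | nil => exact ⟨L₁, [], [], by simp, rfl, by simpa using h₁⟩
  | cons y L₂ ih =>
    rcases List.eq_nil_or_concat L₁ with rfl | ⟨L, x, rfl⟩
    · exact ⟨[], [], y :: L₂, rfl, rfl, h₂⟩
    rw [List.concat_eq_append] at h₁ ⊢
    by_cases hxy : x.1 = y.1 → x.2 = y.2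
    · exact ⟨L ++ [x], [], y :: L₂, by simp, rfl,
        List.IsChain.append_overlap (R := fun a b : α × Bool => a.1 = b.1 → a.2 = b.2) (l₂ := [x])
          h₁ (List.isChain_cons_cons.2 ⟨hxy, h₂⟩) (List.cons_ne_nil _ _)⟩
    · obtain ⟨a, c, d, rfl, rfl, had⟩ := ih h₁.left_of_append
        (List.IsChain.tail h₂)
      refine ⟨a, y :: c, d, ?_, rfl, had⟩
      push Not at hxy
      have : x = (y.1, !y.2) := Prod.ext hxy.1 (by
        have := hxy.2
        revert this
        cases x.2 <;> cases y.2 <;> simp)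
      rw [invRev_cons, this, List.append_assoc]
      rfl

theorem exists_toWord_mul (g h : FreeGroup α) :
    ∃ a c d, g.toWord = a ++ invRev c ∧ h.toWord = c ++ d ∧ (g * h).toWord = a ++ d := by
  obtain ⟨a, c, d, h1, h2, h3⟩ := exists_cancel (isReduced_toWord (x := g))
    (isReduced_toWord (x := h))
  refine ⟨a, c, d, h1, h2, ?_⟩
  have hg : g = mk a * (mk c)⁻¹ := by
    rw [inv_mk, mul_mk, ← h1, mk_toWord]
  have hh : h = mk c * mk d := by
    rw [mul_mk, ← h2, mk_toWord]
  rw [hg, hh, mul_assoc, inv_mul_cancel_left, mul_mk, toWord_mk, h3.reduce_eq]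

theorem balanced_self {g : FreeGroup α} {a c d : List (α × Bool)} (hg : g ≠ 1)
    (h1 : g.toWord = a ++ invRev c) (h2 : g.toWord = c ++ d) : 2 * c.length < (c ++ d).length := by
  by_contra! hlt
  have hlen : a.length = d.length := by
    have := congrArg List.length (h1.symm.trans h2)
    simp only [List.length_append, invRev_length] at this
    omega
  rw [List.length_append] at hlt
  obtain ⟨c', rfl⟩ : ∃ c', c = a ++ c' := by
    refine (List.prefix_of_prefix_length_le (l₃ := g.toWord) ?_ ?_ (by omega)).imp fun _ => Eq.symm
    · exact h1 ▸ List.prefix_append _ _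
    · exact h2 ▸ List.prefix_append _ _
  have h := h1.symm.trans h2
  rw [invRev_append, List.append_assoc, List.append_cancel_left_eq] at h
  obtain ⟨hc, rfl⟩ := List.append_inj h (by rw [invRev_length])
  have hmk : mk c' = 1 := by
    have : mk c' ^ 2 = 1 := by
      rw [pow_two]
      nth_rw 1 [← hc]
      rw [← inv_mk, inv_mul_cancel]
    exact (pow_eq_one_iff_left (two_ne_zero)).1 this
  refine hg ?_
  rw [← mk_toWord (x := g), h2, ← mul_mk, ← mul_mk, hmk, mul_one, ← inv_mk, mul_inv_cancel]

/-- The value of a signed index under a family of elements. -/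
def letter {ι : Type} (b : ι → FreeGroup α) (x : ι × Bool) : FreeGroup α :=
  cond x.2 (b x.1) (b x.1)⁻¹

theorem letter_not {ι : Type} (b : ι → FreeGroup α) (x : ι × Bool) :
    letter b (x.1, !x.2) = (letter b x)⁻¹ := by
  rcases x with ⟨i, _ | _⟩ <;> simp [letter]

theorem lift_mk_append_singleton {ι : Type} (b : ι → FreeGroup α) (L : List (ι × Bool))
    (x : ι × Bool) :
    FreeGroup.lift b (mk (L ++ [x])) = FreeGroup.lift b (mk L) * letter b x := by
  rw [← mul_mk, MonoidHom.map_mul]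
  simp [letter]

theorem letter_ne_one {ι : Type} {b : ι → FreeGroup α} (hb : ∀ i, b i ≠ 1) (x : ι × Bool) :
    letter b x ≠ 1 := by
  rcases x with ⟨i, _ | _⟩ <;> simp [letter, hb]

variable [Fintype α]

/-- A number attached to a word, injective on words of a given length. -/
def code (L : List (α × Bool)) : ℕ :=
  Nat.ofDigits (Fintype.card (α × Bool) + 1) (L.map fun x => (Fintype.equivFin (α × Bool) x : ℕ))

theorem code_append (L L' : List (α × Bool)) :
    code (L ++ L') = code L + (Fintype.card (α × Bool) + 1) ^ L.length * code L' := by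
  simp [code, Nat.ofDigits_append]

theorem code_inj {L L' : List (α × Bool)} (hl : L.length = L'.length) (h : code L = code L') :
    L = L' := by
  have hinj : Function.Injective fun x : α × Bool => (Fintype.equivFin (α × Bool) x : ℕ) :=
    Fin.val_injective.comp (Fintype.equivFin _).injective
  rcases L with _ | ⟨x, L⟩
  · exact (List.length_eq_zero_iff.1 hl.symm).symm
  have hpos : 0 < Fintype.card (α × Bool) := Fintype.card_pos_iff.2 ⟨x⟩
  refine hinj.list_map (Nat.ofDigits_inj_of_len_eq (b := Fintype.card (α × Bool) + 1) (by omega)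
    (by simpa using hl) ?_ ?_ h)
  all_goals
    intro d hd
    obtain ⟨y, -, rfl⟩ := List.mem_map.1 hd
    exact (Fin.is_lt _).trans (Nat.lt_succ_self _)

/-- The sum of the codes of the first halves of a word and of its inverse. -/
def wordKey (L : List (α × Bool)) : ℕ :=
  code (L.take (L.length / 2)) + code ((invRev L).take (L.length / 2))

/-- The contribution to the key of a word of its complement of a short final segment. -/
def wordKeyBase (A : List (α × Bool)) (n : ℕ) : ℕ :=
  code (A.take ((A.length + n) / 2)) +
    (Fintype.card (α × Bool) + 1) ^ n * code ((invRev A).take ((A.length + n) / 2 - n))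

theorem wordKey_append {A d : List (α × Bool)} (h : d.length ≤ A.length) :
    wordKey (A ++ d) = wordKeyBase A d.length + code (invRev d) := by
  rw [wordKey, wordKeyBase, invRev_append, List.length_append,
    List.take_append_of_le_length (by omega), List.take_append, code_append, invRev_length,
    List.take_of_length_le (i := (A.length + d.length) / 2) (l := invRev d)
      (by rw [invRev_length]; omega), invRev_length]
  ring

theorem wordKey_invRev (L : List (α × Bool)) : wordKey (invRev L) = wordKey L := by
  rw [wordKey, wordKey, invRev_invRev, invRev_length, add_comm]

/-- Length and key of an element. -/
def weight (g : FreeGroup α) : ℕ ×ₗ ℕ := toLex (g.toWord.length, wordKey g.toWord)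

/-- Length, key and code of an element. -/
def rank (g : FreeGroup α) : ℕ ×ₗ (ℕ ×ₗ ℕ) :=
  toLex (g.toWord.length, toLex (wordKey g.toWord, code g.toWord))

theorem rank_injective : Function.Injective (rank : FreeGroup α → _) := by
  intro g h hgh
  have h1 := congrArg (fun z => (ofLex z).1) hgh
  have h2 := congrArg (fun z => (ofLex (ofLex z).2).2) hgh
  exact toWord_injective (code_inj h1 h2)

theorem rank_lt_of_weight_lt {g h : FreeGroup α} (hgh : weight g < weight h) : rank g < rank h := by
  simp only [weight, rank, Prod.Lex.toLex_lt_toLex] at hgh ⊢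
  tauto

theorem weight_le_of_rank_le {g h : FreeGroup α} (hgh : rank g ≤ rank h) :
    weight g ≤ weight h :=
  le_of_not_gt fun h' => (rank_lt_of_weight_lt h').not_ge hgh

theorem weight_inv (g : FreeGroup α) : weight g⁻¹ = weight g := by
  rw [weight, weight, toWord_inv, invRev_length, wordKey_invRev]

/-- The conditions on a final segment of a word that limit its cancellation against other words. -/
def Balanced (r t : List (α × Bool)) : Prop :=
  2 * r.length ≤ (r ++ t).length ∧ (2 * r.length = (r ++ t).length → code r < code (invRev t))

theorem balanced_of_weight_le {g h : FreeGroup α} {a c d : List (α × Bool)} (hh : h ≠ 1)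
    (h1 : g.toWord = a ++ invRev c) (h2 : h.toWord = c ++ d) (h3 : (g * h).toWord = a ++ d)
    (hw : weight g ≤ weight (g * h)) (hw' : weight h ≤ weight (g * h)) : Balanced c d := by
  have hl : c.length ≤ d.length ∧ (c.length = d.length → wordKey g.toWord ≤
      wordKey (g * h).toWord) := by
    simp only [weight, Prod.Lex.toLex_le_toLex] at hw
    rw [h1, h3] at hw ⊢
    simp only [List.length_append, invRev_length] at hw
    omega
  have hl' : c.length ≤ a.length := by
    simp only [weight, Prod.Lex.toLex_le_toLex] at hw'
    rw [h2, h3] at hw'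
    simp only [List.length_append] at hw'
    omega
  refine ⟨by rw [List.length_append]; omega, fun hcl => ?_⟩
  rw [List.length_append] at hcl
  have hcd : c.length = d.length := by omega
  have hk := hl.2 hcd
  rw [h1, h3, wordKey_append (by rw [invRev_length]; omega), wordKey_append (by omega),
    invRev_length, invRev_invRev, hcd] at hk
  refine lt_of_le_of_ne (by omega) fun he => hh ?_
  have := code_inj (by rw [invRev_length]; omega) he
  rw [← mk_toWord (x := h), h2, ← mul_mk, this, ← inv_mk, inv_mul_cancel]

section Family

variable {ι : Type} {b : ι → FreeGroup α}

theorem balanced_letter (hb : ∀ i, b i ≠ 1)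
    (hw : ∀ x y : ι × Bool, x.1 ≠ y.1 → weight (letter b x) ≤ weight (letter b x * letter b y))
    {x y : ι × Bool} (hxy : x.1 = y.1 → x.2 = y.2) {a c d : List (α × Bool)}
    (h1 : (letter b x).toWord = a ++ invRev c) (h2 : (letter b y).toWord = c ++ d)
    (h3 : (letter b x * letter b y).toWord = a ++ d) :
    Balanced c d ∧ Balanced c (invRev a) := by
  have hw' : ∀ x y : ι × Bool, x.1 ≠ y.1 →
      weight (letter b y) ≤ weight (letter b x * letter b y) := by
    intro x y h
    have := hw (y.1, !y.2) (x.1, !x.2) h.symm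
    rwa [letter_not, letter_not, ← mul_inv_rev, weight_inv, weight_inv] at this
  by_cases h : x.1 = y.1
  · obtain rfl : x = y := Prod.ext h (hxy h)
    have := balanced_self (letter_ne_one hb x) h1 h2
    have hl := congrArg List.length (h1.symm.trans h2)
    simp only [List.length_append, invRev_length] at hl this
    constructor <;> refine ⟨?_, fun h => ?_⟩ <;>
      simp only [List.length_append, invRev_length] at * <;>
      omega
  · refine ⟨balanced_of_weight_le (letter_ne_one hb y) h1 h2 h3 (hw x y h) (hw' x y h),
      balanced_of_weight_le (g := (letter b y)⁻¹) (h := (letter b x)⁻¹) (a := invRev d)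
        (inv_ne_one.2 (letter_ne_one hb x)) ?_ ?_ ?_ ?_ ?_⟩
    · rw [toWord_inv, h2, invRev_append]
    · rw [toWord_inv, h1, invRev_append, invRev_invRev]
    · rw [← mul_inv_rev, toWord_inv, h3, invRev_append]
    · rw [← mul_inv_rev, weight_inv, weight_inv]
      exact hw' x y h
    · rw [← mul_inv_rev, weight_inv, weight_inv]
      exact hw x y h

/-- The shape of the reduced word of a product of letters. -/
def HasTail (b : ι → FreeGroup α) (x : ι × Bool) (g : FreeGroup α) : Prop :=
  ∃ A r t, g.toWord = A ++ t ∧ (letter b x).toWord = r ++ t ∧ r.length ≤ A.length ∧ Balanced r t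

theorem HasTail.mul (hb : ∀ i, b i ≠ 1)
    (hw : ∀ x y : ι × Bool, x.1 ≠ y.1 → weight (letter b x) ≤ weight (letter b x * letter b y))
    {x y : ι × Bool} (hxy : x.1 = y.1 → x.2 = y.2) {g : FreeGroup α} (hg : HasTail b x g) :
    HasTail b y (g * letter b y) ∧ weight g < weight (g * letter b y) := by
  obtain ⟨A, r, t, h1, h2, hrA, hrt⟩ := hg
  obtain ⟨a, c, d, h3, h4, h5⟩ := exists_toWord_mul (letter b x) (letter b y)
  obtain ⟨hcd, hca⟩ := balanced_letter hb hw hxy h3 h4 h5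
  have hrt' := hrt
  have hcd' := hcd
  simp only [Balanced, List.length_append, invRev_length, invRev_invRev] at hrt hcd hca
  have hl := congrArg List.length (h2.symm.trans h3)
  simp only [List.length_append, invRev_length] at hl
  have hra : r.length < a.length := by
    by_contra! hle
    obtain ⟨rfl, rfl⟩ := List.append_inj (h2.symm.trans h3) (by omega)
    rw [invRev_invRev] at hrt
    have h6 := hrt.2 (by rw [invRev_length]; omega)
    have h7 := hca.2 (by omega)
    omega
  obtain ⟨m, rfl⟩ : ∃ m, a = r ++ m := by
    refine (List.prefix_of_prefix_length_le (l₃ := (letter b x).toWord) ?_ ?_ hra.le).imp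
      fun _ => Eq.symm
    · exact h2 ▸ List.prefix_append _ _
    · exact h3 ▸ List.prefix_append _ _
  have hm : m ≠ [] := by
    rintro rfl
    simp at hra
  obtain rfl : t = m ++ invRev c := by
    have := h2.symm.trans h3
    rwa [List.append_assoc, List.append_cancel_left_eq] at this
  have hred : IsReduced (A ++ m ++ d) := by
    refine IsReduced.append_overlap ?_ ?_ hm
    · have := isReduced_toWord (x := g)
      rw [h1, ← List.append_assoc] at this
      exact List.IsChain.left_of_append this
    · have := isReduced_toWord (x := letter b x * letter b y)
      rw [h5, List.append_assoc] at this
      exact List.IsChain.right_of_append this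
  have hword : (g * letter b y).toWord = A ++ m ++ d := by
    have hg : g = mk (A ++ m) * (mk c)⁻¹ := by
      rw [inv_mk, mul_mk, List.append_assoc, ← h1, mk_toWord]
    have hy : letter b y = mk c * mk d := by
      rw [mul_mk, ← h4, mk_toWord]
    rw [hg, hy, mul_assoc, inv_mul_cancel_left, mul_mk, toWord_mk, hred.reduce_eq]
  simp only [List.length_append, invRev_length] at *
  refine ⟨⟨A ++ m, c, d, hword, h4, by rw [List.length_append]; omega, hcd'⟩, ?_⟩
  rw [weight, weight, Prod.Lex.toLex_lt_toLex, hword, h1, ← List.append_assoc]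
  simp only [List.length_append, invRev_length]
  rcases hcd.1.lt_or_eq with h | h
  · left; omega
  · right
    refine ⟨by omega, ?_⟩
    have hlt := hcd.2 h
    rw [wordKey_append (by rw [invRev_length, List.length_append]; omega),
      wordKey_append (by rw [List.length_append]; omega), invRev_length, invRev_invRev,
      show c.length = d.length by omega]
    omega

end Family

end WordOrder

namespace WordOrder

open Classical FreeGroup

section Products

variable {α : Type} [Fintype α] {ι : Type} {b : ι → FreeGroup α}

theorem hasTail_letter (hb : ∀ i, b i ≠ 1) (x : ι × Bool) : HasTail b x (letter b x) := by
  refine ⟨[], [], (letter b x).toWord, rfl, rfl, le_rfl, by simp, fun h => ?_⟩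
  exact absurd (toWord_eq_nil_iff.1 (List.length_eq_zero_iff.1 (by simpa using h.symm)))
    (letter_ne_one hb x)

theorem hasTail_lift_mk (hb : ∀ i, b i ≠ 1)
    (hw : ∀ x y : ι × Bool, x.1 ≠ y.1 → weight (letter b x) ≤ weight (letter b x * letter b y))
    (L : List (ι × Bool)) (x : ι × Bool) (h : IsReduced (L ++ [x])) :
    HasTail b x (FreeGroup.lift b (mk (L ++ [x]))) ∧
      (L ≠ [] → weight (FreeGroup.lift b (mk L)) < weight (FreeGroup.lift b (mk (L ++ [x])))) := by
  induction L using List.reverseRecOn generalizing x with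
  | nil =>
    refine ⟨?_, fun h => absurd rfl h⟩
    rw [lift_mk_append_singleton, ← one_eq_mk, MonoidHom.map_one, one_mul]
    exact hasTail_letter hb x
  | append_singleton L y ih =>
    have hyx : y.1 = x.1 → y.2 = x.2 := by
      rw [List.append_assoc] at h
      exact (List.isChain_pair (R := fun a b : ι × Bool => a.1 = b.1 → a.2 = b.2)).1
        (List.IsChain.right_of_append h)
    rw [lift_mk_append_singleton]
    have := HasTail.mul hb hw hyx (ih y (List.IsChain.left_of_append h)).1
    exact ⟨this.1, fun _ => this.2⟩

theorem weight_left_part (hb : ∀ i, b i ≠ 1)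
    (hw : ∀ x y : ι × Bool, x.1 ≠ y.1 → weight (letter b x) ≤ weight (letter b x * letter b y))
    (L L' : List (ι × Bool)) (hL : L ≠ []) (h : IsReduced (L ++ L')) :
    weight (FreeGroup.lift b (mk L)) ≤ weight (FreeGroup.lift b (mk (L ++ L'))) ∧
      (L' ≠ [] → weight (FreeGroup.lift b (mk L)) < weight (FreeGroup.lift b (mk (L ++ L')))) := by
  induction L' using List.reverseRecOn with
  | nil => simp
  | append_singleton L' y ih =>
    rw [← List.append_assoc] at h ⊢
    have h1 := (ih (List.IsChain.left_of_append h)).1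
    have h2 := (hasTail_lift_mk hb hw _ y h).2 (by simp [hL])
    exact ⟨(h1.trans_lt h2).le, fun _ => h1.trans_lt h2⟩

theorem rank_le_of_mem (hb : ∀ i, b i ≠ 1) (hinv : ∀ i, rank (b i) ≤ rank (b i)⁻¹)
    (hw : ∀ x y : ι × Bool, x.1 ≠ y.1 → weight (letter b x) ≤ weight (letter b x * letter b y))
    {w : FreeGroup ι} {x : ι × Bool} (hx : x ∈ w.toWord) :
    rank (b x.1) ≤ rank (FreeGroup.lift b w) := by
  obtain ⟨L₁, L₂, hL⟩ := List.append_of_mem hx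
  have hred : IsReduced (L₁ ++ x :: L₂) := hL ▸ isReduced_toWord
  have hwt : weight (b x.1) = weight (letter b x) := by
    rcases x with ⟨i, _ | _⟩ <;> simp [letter, weight_inv]
  have hsingle : ∀ y : ι × Bool, FreeGroup.lift b (mk [y]) = letter b y := by
    intro y
    simp [letter]
  have hred' : IsReduced ((L₁ ++ [x]) ++ L₂) := by simpa using hred
  have hpre := weight_left_part hb hw (L₁ ++ [x]) L₂ (by simp) hred'
  have hsuf := weight_left_part hb hw [(x.1, !x.2)] (invRev L₁) (by simp) (by
    have : IsReduced (L₁ ++ [x]) := List.IsChain.left_of_append hred'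
    rw [isReduced_iff_reduce_eq] at this ⊢
    have h := reduce_invRev (w := L₁ ++ [x])
    rw [this, invRev_append] at h
    exact h)
  have hmk : FreeGroup.lift b (mk ([(x.1, !x.2)] ++ invRev L₁)) =
      (FreeGroup.lift b (mk (L₁ ++ [x])))⁻¹ := by
    rw [← MonoidHom.map_inv, inv_mk, invRev_append]
    rfl
  rw [hmk, weight_inv, hsingle, letter_not, weight_inv, ← hwt] at hsuf
  rw [show (L₁ ++ [x]) ++ L₂ = w.toWord by simp [hL], mk_toWord] at hpre
  by_cases h : L₁ = [] ∧ L₂ = []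
  · obtain ⟨rfl, rfl⟩ := h
    rw [← mk_toWord (x := w), hL, List.nil_append, hsingle]
    rcases x with ⟨i, _ | _⟩
    · exact hinv i
    · exact le_rfl
  · refine (rank_lt_of_weight_lt ?_).le
    by_cases h2 : L₂ = []
    · exact (hsuf.2 fun h1 => h ⟨invRev_injective h1, h2⟩).trans_le hpre.1
    · exact hsuf.1.trans_lt (hpre.2 h2)

end Products

end WordOrder

namespace FreeForm

open Classical WordOrder

section Chambers

variable {α : Type} [Fintype α] [LinearOrder α]

/-- The lexicographic order on automorphisms, comparing the ranks of the preimages of the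
generators. -/
def chamberLT (m m' : MulAut (FreeGroup α)) : Prop :=
  Pi.Lex (· < ·) (· < ·) (fun i => rank (m⁻¹ (FreeGroup.of i)))
    (fun i => rank (m'⁻¹ (FreeGroup.of i)))

theorem chamberLT_wf : WellFounded (chamberLT (α := α)) :=
  InvImage.wf (fun (m : MulAut (FreeGroup α)) i => rank (m⁻¹ (FreeGroup.of i)))
    (Pi.Lex.wellFounded (ι := α) (α := fun _ => ℕ ×ₗ (ℕ ×ₗ ℕ)) (r := (· < ·))
      (fun _ => wellFounded_lt))

theorem chamberLT_trichotomy {m m' : MulAut (FreeGroup α)} (h : ¬ chamberLT m m')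
    (h' : ¬ chamberLT m' m) : m = m' := by
  have key : (fun i => rank (m⁻¹ (FreeGroup.of i))) = fun i => rank (m'⁻¹ (FreeGroup.of i)) :=
    (Pi.trichotomous_lex (fun x1 x2 : α => x1 < x2)
      (fun {_} (x1 x2 : ℕ ×ₗ (ℕ ×ₗ ℕ)) => x1 < x2) wellFounded_lt).1 _ _ h h'
  have : m⁻¹.toMonoidHom = m'⁻¹.toMonoidHom :=
    FreeGroup.ext_hom _ _ fun i => rank_injective (congrFun key i)
  rw [← inv_inj]
  ext w
  exact DFunLike.congr_fun this w

theorem chamberLT_of_update {m ρ : MulAut (FreeGroup α)} {i : α}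
    (hρ : ∀ k < i, ρ (FreeGroup.of k) = FreeGroup.of k)
    (h : rank (m⁻¹ (ρ (FreeGroup.of i))) < rank (m⁻¹ (FreeGroup.of i))) :
    chamberLT (ρ⁻¹ * m) m := by
  refine ⟨i, fun k hk => ?_, ?_⟩ <;> simp only [mul_inv_rev, inv_inv, MulAut.mul_apply]
  · rw [hρ k hk]
  · exact h

end Chambers

end FreeForm

namespace FreeForm

open Classical WordOrder

section Moves

variable {α : Type}

theorem exists_rank_le [Fintype α] {ι : Type} {b : ι → FreeGroup α} (hb : ∀ i, b i ≠ 1)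
    (hinv : ∀ i, rank (b i) ≤ rank (b i)⁻¹)
    (hw : ∀ x y : ι × Bool, x.1 ≠ y.1 → weight (letter b x) ≤ weight (letter b x * letter b y))
    {M : Type} [Group M] {f g : FreeGroup ι →* M} {P : ι → Prop}
    (hfg : ∀ l, P l → f (FreeGroup.of l) = g (FreeGroup.of l)) {w : FreeGroup ι}
    (hne : f w ≠ g w) : ∃ l, ¬ P l ∧ rank (b l) ≤ rank (FreeGroup.lift b w) := by
  by_contra! hcon
  refine hne ?_
  have key : ∀ L : List (ι × Bool), (∀ x ∈ L, P x.1) →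
      f (FreeGroup.mk L) = g (FreeGroup.mk L) := by
    intro L hL
    induction L with
    | nil => rw [← FreeGroup.one_eq_mk, map_one, map_one]
    | cons x L ih =>
      have hx : f (FreeGroup.mk [x]) = g (FreeGroup.mk [x]) := by
        have := hfg x.1 (hL x List.mem_cons_self)
        rcases x with ⟨i, _ | _⟩
        · rw [show FreeGroup.mk [(i, false)] = (FreeGroup.of i)⁻¹ from rfl, map_inv, map_inv, this]
        · exact this
      rw [← List.singleton_append, ← FreeGroup.mul_mk, map_mul, map_mul, hx,
        ih fun y hy => hL y (List.mem_cons_of_mem _ hy)]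
  rw [← FreeGroup.mk_toWord (x := w)]
  refine key _ fun x hx => ?_
  by_contra hP
  exact (hcon x.1 hP).not_ge (rank_le_of_mem hb hinv hw hx)

theorem mem_stab {s : Set α} {ψ : MulAut (FreeGroup α)}
    (h1 : ∀ i ∈ s, ψ (FreeGroup.of i) = FreeGroup.of i)
    (h2 : ∀ i ∉ s, kill s (ψ (FreeGroup.of i)) = ψ (FreeGroup.of i)) : ψ ∈ stab s := by
  refine ⟨h1, fun w => ?_⟩
  have : ψ.toMonoidHom.comp (kill s) = (kill s).comp ψ.toMonoidHom := by
    refine FreeGroup.ext_hom _ _ fun a => ?_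
    simp only [MonoidHom.comp_apply, MulEquiv.coe_toMonoidHom]
    by_cases ha : a ∈ s
    · rw [h1 a ha, kill_of_mem ha, map_one]
    · rw [kill_of_notMem ha, h2 a ha]
  exact DFunLike.congr_fun this w

/-- The automorphism inverting the generator `i`. -/
def invertAut (i : α) : MulAut (FreeGroup α) :=
  MonoidHom.toMulEquiv
    (FreeGroup.lift fun a => if a = i then (FreeGroup.of a)⁻¹ else FreeGroup.of a)
    (FreeGroup.lift fun a => if a = i then (FreeGroup.of a)⁻¹ else FreeGroup.of a)
    (by ext a; by_cases h : a = i <;> simp [h])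
    (by ext a; by_cases h : a = i <;> simp [h])

theorem invertAut_self (i : α) : invertAut i (FreeGroup.of i) = (FreeGroup.of i)⁻¹ := by
  simp [invertAut]

theorem invertAut_of_ne {i a : α} (h : a ≠ i) :
    invertAut i (FreeGroup.of a) = FreeGroup.of a := by
  simp [invertAut, h]

theorem invertAut_mem_stab {i : α} {s : Set α} (hi : i ∉ s) : invertAut i ∈ stab s := by
  refine mem_stab (fun a ha => invertAut_of_ne fun h => hi (h ▸ ha)) fun a ha => ?_
  by_cases h : a = i
  · subst h
    rw [invertAut_self, map_inv, kill_of_notMem ha]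
  · rw [invertAut_of_ne h, kill_of_notMem ha]

/-- The automorphism exchanging two generators. -/
def swapAut (i j : α) : MulAut (FreeGroup α) := FreeGroup.freeGroupCongr (Equiv.swap i j)

theorem swapAut_of (i j a : α) :
    swapAut i j (FreeGroup.of a) = FreeGroup.of (Equiv.swap i j a) := by
  simp [swapAut]

theorem swapAut_left (i j : α) : swapAut i j (FreeGroup.of i) = FreeGroup.of j := by
  rw [swapAut_of, Equiv.swap_apply_left]

theorem swapAut_of_ne {i j a : α} (hi : a ≠ i) (hj : a ≠ j) :
    swapAut i j (FreeGroup.of a) = FreeGroup.of a := by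
  rw [swapAut_of, Equiv.swap_apply_of_ne_of_ne hi hj]

theorem swapAut_mem_stab {i j : α} {s : Set α} (hi : i ∉ s) (hj : j ∉ s) :
    swapAut i j ∈ stab s := by
  refine mem_stab (fun a ha => ?_) fun a ha => ?_
  · exact swapAut_of_ne (fun h => hi (h ▸ ha)) fun h => hj (h ▸ ha)
  · rw [swapAut_of, kill_of_notMem]
    rw [Equiv.swap_apply_def]
    split_ifs <;> assumption

theorem exists_right_mul {i j : α} (hij : i ≠ j) (ε : Bool) : ∃ ρ : MulAut (FreeGroup α),
    ρ (FreeGroup.of i) = FreeGroup.of i * letter FreeGroup.of (j, ε) ∧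
      (∀ a, a ≠ i → ρ (FreeGroup.of a) = FreeGroup.of a) ∧
      ∀ s : Set α, i ∉ s → j ∉ s → ρ ∈ stab s := by
  have hj : j ∉ ({i} : Set α) := fun h => hij h.symm
  let ρ := transvect (s := {i}) (x := i) rfl
    (cond ε (FreeGroup.of ⟨j, hj⟩) (FreeGroup.of ⟨j, hj⟩)⁻¹)
  have h1 : ρ (FreeGroup.of i) = FreeGroup.of i * letter FreeGroup.of (j, ε) := by
    refine (transvect_self _ _).trans ?_
    cases ε <;> simp [letter]
  have h2 : ∀ a, a ≠ i → ρ (FreeGroup.of a) = FreeGroup.of a :=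
    fun a ha => transvect_of_ne _ _ ha
  refine ⟨ρ, h1, h2, fun s hi hjs => mem_stab (fun a ha => h2 a fun h => hi (h ▸ ha)) ?_⟩
  intro a ha
  by_cases h : a = i
  · subst h
    rw [h1, map_mul, kill_of_notMem ha]
    cases ε <;> simp [letter, kill_of_notMem hjs]
  · rw [h2 a h, kill_of_notMem ha]

theorem exists_left_mul {i j : α} (hij : i ≠ j) (ε : Bool) : ∃ ρ : MulAut (FreeGroup α),
    ρ (FreeGroup.of i) = letter FreeGroup.of (j, ε) * FreeGroup.of i ∧
      (∀ a, a ≠ i → ρ (FreeGroup.of a) = FreeGroup.of a) ∧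
      ∀ s : Set α, i ∉ s → j ∉ s → ρ ∈ stab s := by
  obtain ⟨ρ, h1, h2, h3⟩ := exists_right_mul hij (!ε)
  refine ⟨invertAut i * ρ * invertAut i, ?_, fun a ha => ?_, fun s hi hj =>
    mul_mem (mul_mem (invertAut_mem_stab hi) (h3 s hi hj)) (invertAut_mem_stab hi)⟩
  · rw [MulAut.mul_apply, MulAut.mul_apply, invertAut_self, map_inv, h1, map_inv, map_mul,
      invertAut_self]
    cases ε <;> simp [letter, invertAut_of_ne hij.symm]
  · rw [MulAut.mul_apply, MulAut.mul_apply, invertAut_of_ne ha, h2 a ha, invertAut_of_ne ha]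

end Moves

section Nielsen

variable {α : Type} [Fintype α] [LinearOrder α]

theorem exists_pair {s : Set α} {ψ m : MulAut (FreeGroup α)} (hψ : ψ ∈ stab s)
    (h : chamberLT (ψ * m) m) : ∃ τ : Finset α, τ.card ≤ 2 ∧ (∀ i ∈ τ, i ∉ s) ∧
      ∃ ψ' ∈ stab ((τ : Set α)ᶜ), chamberLT (ψ' * m) m := by
  by_contra! hno
  have hmove : ∀ i j, i ∉ s → j ∉ s → ∀ ρ : MulAut (FreeGroup α),
      (∀ t : Set α, i ∉ t → j ∉ t → ρ ∈ stab t) → (∀ k < i, ρ (FreeGroup.of k) = FreeGroup.of k) →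
      rank (m⁻¹ (FreeGroup.of i)) ≤ rank (m⁻¹ (ρ (FreeGroup.of i))) := by
    intro i j hi hj ρ hρ hk
    by_contra! hlt
    refine hno {i, j} Finset.card_le_two ?_ ρ⁻¹ (inv_mem (hρ _ ?_ ?_))
      (chamberLT_of_update hk hlt)
    · intro a ha
      rcases Finset.mem_insert.1 ha with rfl | ha
      · exact hi
      · rwa [Finset.mem_singleton.1 ha]
    · simp
    · simp
  let b : {i // i ∉ s} → FreeGroup α := fun i => m⁻¹ (FreeGroup.of i.1)
  have hlift : ∀ w, FreeGroup.lift b w = m⁻¹ (inc s w) := by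
    intro w
    have : FreeGroup.lift b = (m⁻¹).toMonoidHom.comp (inc s) :=
      FreeGroup.ext_hom _ _ fun a => by simp [b]
    rw [this]
    rfl
  have hb : ∀ i, b i ≠ 1 := fun i => by simp [b]
  have hinv : ∀ i, rank (b i) ≤ rank (b i)⁻¹ := by
    intro i
    have := hmove i.1 i.1 i.2 i.2 (invertAut i.1) (fun t ht _ => invertAut_mem_stab ht)
      fun k hk => invertAut_of_ne hk.ne
    rwa [invertAut_self, map_inv] at this
  have hletter : ∀ (j : {i // i ∉ s}) (ε : Bool),
      m⁻¹ (letter FreeGroup.of (j.1, ε)) = letter b (j, ε) := by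
    intro j ε
    cases ε <;> simp [letter, b]
  have hw : ∀ x y : {i // i ∉ s} × Bool, x.1 ≠ y.1 →
      weight (letter b x) ≤ weight (letter b x * letter b y) := by
    rintro ⟨i, ε⟩ ⟨j, δ⟩ hij
    have hij' : i.1 ≠ j.1 := fun h => hij (Subtype.ext h)
    cases ε
    · obtain ⟨ρ, h1, h2, h3⟩ := exists_left_mul hij' (!δ)
      have := weight_le_of_rank_le (hmove i.1 j.1 i.2 j.2 ρ h3 fun k hk => h2 k hk.ne)
      rw [h1, map_mul, hletter, letter_not b (j, δ)] at this
      rw [show letter b (i, false) = (b i)⁻¹ from rfl, weight_inv, ← weight_inv (_ * _),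
        mul_inv_rev, inv_inv]
      exact this
    · obtain ⟨ρ, h1, h2, h3⟩ := exists_right_mul hij' δ
      have := weight_le_of_rank_le (hmove i.1 j.1 i.2 j.2 ρ h3 fun k hk => h2 k hk.ne)
      rwa [h1, map_mul, hletter] at this
  obtain ⟨k, hk1, hk2⟩ := h
  simp only [mul_inv_rev, MulAut.mul_apply] at hk1 hk2
  replace hk1 : ∀ j < k, ψ⁻¹ (FreeGroup.of j) = FreeGroup.of j :=
    fun j hj => (m⁻¹).injective (rank_injective (hk1 j hj))
  have hks : k ∉ s := fun hks => by
    rw [(inv_mem hψ).1 k hks] at hk2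
    exact lt_irrefl _ hk2
  have hv : inc s (ret s (ψ⁻¹ (FreeGroup.of k))) = ψ⁻¹ (FreeGroup.of k) := by
    rw [inc_ret, ← (inv_mem hψ).2, kill_of_notMem hks]
  have hne : (ψ⁻¹).toMonoidHom.comp (inc s) (ret s (ψ⁻¹ (FreeGroup.of k))) ≠
      inc s (ret s (ψ⁻¹ (FreeGroup.of k))) := by
    intro heq
    rw [MonoidHom.comp_apply, MulEquiv.coe_toMonoidHom, hv] at heq
    rw [(ψ⁻¹).injective heq] at hk2
    exact lt_irrefl _ hk2
  obtain ⟨l, hl, hle⟩ := exists_rank_le hb hinv hw (P := fun l => l.1 < k)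
    (fun l hl => by simpa using hk1 l.1 hl) hne
  rw [hlift, hv] at hle
  rcases (not_lt.1 hl).eq_or_lt with hkl | hkl
  · simp only [b, ← hkl] at hle
    exact hle.not_gt hk2
  · have := hmove k l.1 hks l.2 (swapAut k l.1) (fun t => swapAut_mem_stab) fun j hj =>
      swapAut_of_ne hj.ne (hj.trans hkl).ne
    rw [swapAut_left] at this
    exact (this.trans hle).not_gt hk2

end Nielsen

end FreeForm

namespace FreeForm

open Classical TupleComplex

section Differential

variable {α : Type} {j : ℕ}

theorem pb_kill_apply_of_forall_notMem {s : Set α} (ω : Form j (FreeGroup α)) {a : Fin j → α}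
    (ha : ∀ l, a l ∉ s) : (pb j (kill s) ω).1 (FreeGroup.of ∘ a) = ω.1 (FreeGroup.of ∘ a) := by
  rw [pb_apply]
  exact congrArg ω.1 (funext fun l => kill_of_notMem (ha l))

theorem pb_kill_apply_of_mem {s : Set α} (ω : Form j (FreeGroup α)) {a : Fin j → α} {l : Fin j}
    (ha : a l ∈ s) : (pb j (kill s) ω).1 (FreeGroup.of ∘ a) = 0 := by
  rw [pb_apply]
  exact Form.eq_zero_of_apply_one ω _ l (kill_of_mem ha)

theorem pb_kill_pb_kill {s s' : Set α} (h : s' ⊆ s) (ω : Form j (FreeGroup α)) :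
    pb j (kill s) (pb j (kill s') ω) = pb j (kill s) ω := by
  rw [pb_pb, kill_comp_kill h]

theorem pb_kill_formRep {s : Set α} {ψ : MulAut (FreeGroup α)} (hψ : ψ ∈ stab s)
    (ω : Form j (FreeGroup α)) :
    pb j (kill s) (formRep j _ ψ ω) = formRep j _ ψ (pb j (kill s) ω) := by
  rw [formRep_eq, formRep_eq, pb_pb, pb_pb]
  have : (ψ⁻¹).toMonoidHom.comp (kill s) = (kill s).comp (ψ⁻¹).toMonoidHom :=
    MonoidHom.ext fun w => (inv_mem hψ).2 w
  rw [this]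

theorem range_comp_subset {q r : ℕ} (s : Fin q → α) (f : Fin r → Fin q) :
    Set.range (s ∘ f) ⊆ Set.range s := Set.range_comp_subset_range f s

/-- The differential on tuples of forms, restricting to the complementary free factor. -/
def diff (j q : ℕ) : ((Fin q → α) → Form j (FreeGroup α)) →+
    ((Fin (q + 1) → α) → Form j (FreeGroup α)) :=
  AddMonoidHom.mk' (fun u s => pb j (kill (Set.range s)) (face q u s)) (by
    intro u v
    ext s : 1
    rw [map_add, Pi.add_apply, map_add]
    rfl)

theorem diff_apply (q : ℕ) (u : (Fin q → α) → Form j (FreeGroup α)) (s : Fin (q + 1) → α) :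
    diff j q u s = pb j (kill (Set.range s)) (face q u s) := rfl

theorem diff_diff (q : ℕ) (u : (Fin q → α) → Form j (FreeGroup α)) :
    diff j (q + 1) (diff j q u) = 0 := by
  ext s : 1
  rw [diff_apply, map_face]
  have : face (q + 1) (fun t => pb j (kill (Set.range s)) (diff j q u t)) s =
      face (q + 1) (fun t => pb j (kill (Set.range s)) (face q u t)) s :=
    face_congr fun k => pb_kill_pb_kill (range_comp_subset s _) _
  rw [this, ← map_face, face_face]
  exact map_zero _

variable (α) in
/-- The module of functions on automorphisms with values in tuples of forms, such that the value
at a tuple is a form on the complementary free factor, equivariant under its automorphisms. -/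
def cplx (j q : ℕ) : AddSubgroup (MulAut (FreeGroup α) → (Fin q → α) → Form j (FreeGroup α)) where
  carrier := {E | (∀ g s, pb j (kill (Set.range s)) (E g s) = E g s) ∧
    ∀ s, ∀ ψ ∈ stab (Set.range s), ∀ g, E (ψ * g) s = formRep j _ ψ (E g s)}
  add_mem' := by
    rintro E E' ⟨h1, h2⟩ ⟨h3, h4⟩
    refine ⟨fun g s => ?_, fun s ψ hψ g => ?_⟩
    · simp only [Pi.add_apply, map_add, h1, h3]
    · simp only [Pi.add_apply, map_add, h2 s ψ hψ, h4 s ψ hψ]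
  zero_mem' := by
    refine ⟨fun g s => ?_, fun s ψ hψ g => ?_⟩
    · exact map_zero _
    · exact (map_zero _).symm
  neg_mem' := by
    rintro E ⟨h1, h2⟩
    refine ⟨fun g s => ?_, fun s ψ hψ g => ?_⟩
    · simp only [Pi.neg_apply, map_neg, h1]
    · simp only [Pi.neg_apply, map_neg, h2 s ψ hψ]

theorem formRep_face {q : ℕ} (ψ : MulAut (FreeGroup α)) (u : (Fin q → α) → Form j (FreeGroup α))
    (s : Fin (q + 1) → α) :
    face q (fun t => formRep j _ ψ (u t)) s = formRep j _ ψ (face q u s) :=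
  (map_face (formRep j (FreeGroup α) ψ).toAddMonoidHom q u s).symm

theorem diff_eq_formRep {q : ℕ} {s : Fin (q + 1) → α} {ψ : MulAut (FreeGroup α)}
    (hψ : ψ ∈ stab (Set.range s)) {u v : (Fin q → α) → Form j (FreeGroup α)}
    (h : ∀ k : Fin (q + 1), u (s ∘ k.succAbove) = formRep j _ ψ (v (s ∘ k.succAbove))) :
    diff j q u s = formRep j _ ψ (diff j q v s) := by
  rw [diff_apply, diff_apply, ← pb_kill_formRep hψ, ← formRep_face]
  congr 1
  exact face_congr h

theorem diff_mem_cplx {q : ℕ} {E : MulAut (FreeGroup α) → (Fin q → α) → Form j (FreeGroup α)}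
    (hE : E ∈ cplx α j q) : (fun g => diff j q (E g)) ∈ cplx α j (q + 1) := by
  refine ⟨fun g s => pb_kill_pb_kill le_rfl _, fun s ψ hψ g => diff_eq_formRep hψ fun k => ?_⟩
  exact hE.2 _ ψ (stab_anti (range_comp_subset s _) hψ) g

theorem eq_zero_of_diff_eq_zero [Fintype α] (hj : j < Fintype.card α)
    {E : MulAut (FreeGroup α) → (Fin 0 → α) → Form j (FreeGroup α)}
    (hE : ∀ g, diff j 0 (E g) = 0) : E = 0 := by
  ext g t : 2
  refine form_ext fun a => ?_
  obtain ⟨v, hv⟩ : ∃ v, v ∉ Set.range a := by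
    by_contra! h
    have := Fintype.card_le_of_surjective a h
    rw [Fintype.card_fin] at this
    omega
  have := congrFun (hE g) fun _ => v
  rw [diff_apply, face_zero_apply] at this
  rw [Subsingleton.elim t default, ← pb_kill_apply_of_forall_notMem
    (s := Set.range fun _ : Fin 1 => v), this]
  · rfl
  · rintro l ⟨_, h⟩
    exact hv ⟨l, h.symm⟩

end Differential

section Exactness

variable {α : Type} [Fintype α] [LinearOrder α] {j : ℕ}

/-- Minimality in a coset of the stabilizer of a set of generators. -/
def IsMin (s : Set α) (m : MulAut (FreeGroup α)) : Prop :=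
  ∀ ψ ∈ stab s, ¬ chamberLT (ψ * m) m

/-- The least element of a coset of the stabilizer of a set of generators. -/
def base (s : Set α) (m : MulAut (FreeGroup α)) : MulAut (FreeGroup α) :=
  chamberLT_wf.min {m' | ∃ ψ ∈ stab s, ψ * m = m'} ⟨m, 1, one_mem _, one_mul m⟩

theorem exists_mul_eq_base (s : Set α) (m : MulAut (FreeGroup α)) :
    ∃ ψ ∈ stab s, ψ * m = base s m :=
  chamberLT_wf.min_mem {m' | ∃ ψ ∈ stab s, ψ * m = m'} ⟨m, 1, one_mem _, one_mul m⟩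

theorem mul_base_inv_mem (s : Set α) (m : MulAut (FreeGroup α)) : m * (base s m)⁻¹ ∈ stab s := by
  obtain ⟨ψ, hψ, h⟩ := exists_mul_eq_base s m
  rw [← h, mul_inv_rev, mul_inv_cancel_left]
  exact inv_mem hψ

theorem not_chamberLT_base {s : Set α} {ψ : MulAut (FreeGroup α)} (hψ : ψ ∈ stab s)
    (m : MulAut (FreeGroup α)) : ¬ chamberLT (ψ * m) (base s m) :=
  chamberLT_wf.not_lt_min {m' | ∃ ψ ∈ stab s, ψ * m = m'} ⟨ψ, hψ, rfl⟩

theorem base_mul {s : Set α} {ψ : MulAut (FreeGroup α)} (hψ : ψ ∈ stab s)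
    (m : MulAut (FreeGroup α)) : base s (ψ * m) = base s m := by
  have : {m' | ∃ φ ∈ stab s, φ * (ψ * m) = m'} = {m' | ∃ φ ∈ stab s, φ * m = m'} := by
    ext m'
    constructor
    · rintro ⟨φ, hφ, rfl⟩
      exact ⟨φ * ψ, mul_mem hφ hψ, mul_assoc _ _ _⟩
    · rintro ⟨φ, hφ, rfl⟩
      exact ⟨φ * ψ⁻¹, mul_mem hφ (inv_mem hψ), by group⟩
  unfold base
  congr 1

theorem IsMin.base_eq {s : Set α} {m : MulAut (FreeGroup α)} (h : IsMin s m) : base s m = m := by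
  obtain ⟨ψ, hψ, he⟩ := exists_mul_eq_base s m
  refine chamberLT_trichotomy (he ▸ h ψ hψ) ?_
  have := not_chamberLT_base (one_mem (stab s)) m
  rwa [one_mul] at this

theorem chamberLT_base {s : Set α} {m : MulAut (FreeGroup α)} (h : ¬ IsMin s m) :
    chamberLT (base s m) m := by
  by_contra hlt
  have hm := not_chamberLT_base (one_mem (stab s)) m
  rw [one_mul] at hm
  have := chamberLT_trichotomy hlt hm
  refine h fun ψ hψ hψm => not_chamberLT_base hψ m ?_
  rwa [this]

theorem IsMin.mono {s t : Set α} (h : t ⊆ s) {m : MulAut (FreeGroup α)} (hm : IsMin t m) :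
    IsMin s m := fun ψ hψ => hm ψ (stab_anti h hψ)

/-- The value at `m` of the equivariant extension of the values at smaller automorphisms. -/
def forced {q : ℕ} (m : MulAut (FreeGroup α))
    (E : (m' : MulAut (FreeGroup α)) → chamberLT m' m → (Fin q → α) → Form j (FreeGroup α)) :
    (Fin q → α) → Form j (FreeGroup α) := fun t =>
  if h : IsMin (Set.range t) m then 0 else
    formRep j _ (m * (base (Set.range t) m)⁻¹) (E (base (Set.range t) m) (chamberLT_base h) t)

/-- The conditions on the value at `m` of a primitive of `C`, given its values at smaller
automorphisms. -/
def IsPrimitiveAt {q : ℕ} (c : (Fin (q + 1) → α) → Form j (FreeGroup α))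
    (m : MulAut (FreeGroup α)) (K u : (Fin q → α) → Form j (FreeGroup α)) : Prop :=
  (∀ t, ¬ IsMin (Set.range t) m → u t = K t) ∧
    (∀ t, pb j (kill (Set.range t)) (u t) = u t) ∧ diff j q u = c

theorem exists_correction {q : ℕ} (hcard : 2 * (q + 1) + 1 + j ≤ Fintype.card α)
    (m : MulAut (FreeGroup α)) (c : (Fin (q + 1) → α) → Form j (FreeGroup α))
    (hck : ∀ s, pb j (kill (Set.range s)) (c s) = c s)
    (hc : diff j (q + 1) c = 0) (hcm : ∀ s, ¬ IsMin (Set.range s) m → c s = 0) :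
    ∃ u, IsPrimitiveAt c m 0 u := by
  let V : (Fin j → α) → Finset α := fun a => Finset.univ.filter fun v => v ∉ Set.range a
  have hV : ∀ {a v}, v ∈ V a ↔ v ∉ Set.range a := by simp [V]
  have hVs : ∀ {a : Fin j → α} {r : ℕ} {s : Fin r → α}, (∀ i, s i ∈ V a) →
      ∀ l, a l ∉ Set.range s := by
    rintro a r s hs l ⟨i, hi⟩
    exact hV.1 (hs i) ⟨l, hi.symm⟩
  have hVc : ∀ {a : Fin j → α} {r : ℕ} {s : Fin r → α}, ¬ (∀ i, s i ∈ V a) →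
      ∃ l, a l ∈ Set.range s := by
    intro a r s hs
    push Not at hs
    obtain ⟨i, hi⟩ := hs
    obtain ⟨l, hl⟩ := not_not.1 fun h => hi (hV.2 h)
    exact ⟨l, i, hl.symm⟩
  let T : Finset (Finset α) := Finset.univ.filter fun τ =>
    τ.card ≤ 2 ∧ ∃ ψ ∈ stab ((τ : Set α)ᶜ), chamberLT (ψ * m) m
  have hVcard : ∀ a, 2 * (q + 1) + 1 ≤ (V a).card := by
    intro a
    have h1 : (V a).card = Fintype.card α - (Finset.univ.image a).card := by
      rw [← Finset.card_compl]
      congr 1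
      ext v
      simp [V]
    have h2 : (Finset.univ.image a).card ≤ j := by
      simpa using Finset.card_image_le (s := Finset.univ) (f := a)
    omega
  have local_sol : ∀ a, IsFace (V a) T (q + 1) fun s => (c s).1 (FreeGroup.of ∘ a) := by
    intro a
    refine isFace_of_face_eq_zero T (fun τ hτ => (Finset.mem_filter.1 hτ).2.1) (q + 1) (V a)
      (hVcard a) _ (fun s hs => ?_) fun t _ τ hτ htτ => ?_
    · let ev : Form j (FreeGroup α) →+ ℤ := AddMonoidHom.mk'
        (fun ω => ω.1 (FreeGroup.of ∘ a)) fun _ _ => rfl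
      have := map_face ev (q + 1) c s
      change _ = face (q + 1) (fun s => (c s).1 (FreeGroup.of ∘ a)) s at this
      rw [← this]
      change (face (q + 1) c s).1 _ = 0
      rw [← pb_kill_apply_of_forall_notMem _ (hVs hs), ← diff_apply, hc]
      rfl
    · obtain ⟨ψ, hψ, hlt⟩ := (Finset.mem_filter.1 hτ).2.2
      rw [hcm t fun hmin => hmin ψ (stab_anti ?_ hψ) hlt]
      · rfl
      · rintro _ ⟨i, rfl⟩
        simpa using htτ i
  choose e he1 he2 using local_sol
  choose u hu using fun t : Fin q → α =>
    exists_form fun a => if ∀ i, t i ∈ V a then e a t else 0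
  refine ⟨u, fun t ht => form_ext fun a => ?_, fun t => form_ext fun a => ?_, ?_⟩
  · rw [hu]
    change _ = (0 : ℤ)
    split_ifs with h
    · unfold IsMin at ht
      push Not at ht
      obtain ⟨ψ, hψ, hlt⟩ := ht
      obtain ⟨τ, h1, h2, h3⟩ := exists_pair hψ hlt
      exact he2 a t h τ (by simpa [T] using ⟨h1, h3⟩) fun i hi => h2 _ hi ⟨i, rfl⟩
    · rfl
  · by_cases h : ∀ i, t i ∈ V a
    · exact pb_kill_apply_of_forall_notMem _ (hVs h)
    · obtain ⟨l, hl⟩ := hVc h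
      rw [pb_kill_apply_of_mem _ hl, hu, if_neg h]
  · ext s : 1
    refine form_ext fun a => ?_
    by_cases h : ∀ i, s i ∈ V a
    · rw [diff_apply, pb_kill_apply_of_forall_notMem _ (hVs h)]
      let ev : Form j (FreeGroup α) →+ ℤ := AddMonoidHom.mk'
        (fun ω => ω.1 (FreeGroup.of ∘ a)) fun _ _ => rfl
      refine (map_face ev q u s).trans (Eq.trans ?_ (he1 a s h))
      refine face_congr fun k => ?_
      change (u (s ∘ k.succAbove)).1 _ = _
      rw [hu, if_pos]
      exact fun i => h _
    · obtain ⟨l, hl⟩ := hVc h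
      rw [diff_apply, pb_kill_apply_of_mem _ hl, ← hck, pb_kill_apply_of_mem _ hl]

theorem forced_of_isMin {q : ℕ} {m : MulAut (FreeGroup α)}
    {E : (m' : MulAut (FreeGroup α)) → chamberLT m' m → (Fin q → α) → Form j (FreeGroup α)}
    {t : Fin q → α} (h : IsMin (Set.range t) m) : forced m E t = 0 := dif_pos h

theorem forced_of_not_isMin {q : ℕ} {m : MulAut (FreeGroup α)}
    {E : (m' : MulAut (FreeGroup α)) → chamberLT m' m → (Fin q → α) → Form j (FreeGroup α)}
    {t : Fin q → α} (h : ¬ IsMin (Set.range t) m) : forced m E t =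
      formRep j _ (m * (base (Set.range t) m)⁻¹)
        (E (base (Set.range t) m) (chamberLT_base h) t) := dif_neg h

theorem mul_base_inv_eq {s t : Set α} (h : t ⊆ s) (m : MulAut (FreeGroup α)) :
    base t (base s m) = base t m := by
  obtain ⟨ψ, hψ, he⟩ := exists_mul_eq_base s m
  rw [← he, base_mul (stab_anti h hψ)]

/-- The recursive construction of a primitive along the well-order of automorphisms. -/
def primitive {q : ℕ} (C : MulAut (FreeGroup α) → (Fin (q + 1) → α) → Form j (FreeGroup α)) :
    MulAut (FreeGroup α) → (Fin q → α) → Form j (FreeGroup α) :=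
  chamberLT_wf.fix fun m E =>
    if h : ∃ u, IsPrimitiveAt (C m) m (forced m E) u then h.choose else 0

theorem isPrimitiveAt_primitive {q : ℕ} (hcard : 2 * (q + 1) + 1 + j ≤ Fintype.card α)
    {C : MulAut (FreeGroup α) → (Fin (q + 1) → α) → Form j (FreeGroup α)}
    (hC : C ∈ cplx α j (q + 1)) (hd : ∀ g, diff j (q + 1) (C g) = 0)
    (m : MulAut (FreeGroup α)) :
    IsPrimitiveAt (C m) m (forced m fun m' _ => primitive C m') (primitive C m) := by
  refine chamberLT_wf.induction (C := fun m => IsPrimitiveAt (C m) m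
    (forced m fun m' _ => primitive C m') (primitive C m)) m fun m ih => ?_
  suffices h : ∃ u, IsPrimitiveAt (C m) m (forced m fun m' _ => primitive C m') u by
    have he : primitive C m = h.choose := (WellFounded.fix_eq _ _ m).trans (dif_pos h)
    rw [he]
    exact h.choose_spec
  set K := forced m fun m' _ => primitive C m' with hK
  have hKk : ∀ t, pb j (kill (Set.range t)) (K t) = K t := by
    intro t
    by_cases h : IsMin (Set.range t) m
    · rw [hK, forced_of_isMin h, map_zero]
    · rw [hK, forced_of_not_isMin h, pb_kill_formRep (mul_base_inv_mem _ _),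
        (ih _ (chamberLT_base h)).2.1]
  have hKd : ∀ s : Fin (q + 1) → α, ¬ IsMin (Set.range s) m → diff j q K s = C m s := by
    intro s hs
    have hψ := mul_base_inv_mem (Set.range s) m
    rw [← inv_mul_cancel_right m (base (Set.range s) m), hC.2 s _ hψ,
      ← (ih _ (chamberLT_base hs)).2.2]
    refine diff_eq_formRep hψ fun k => ?_
    have hsub := range_comp_subset s k.succAbove
    have ht : ¬ IsMin (Set.range (s ∘ k.succAbove)) m := fun h => hs (h.mono hsub)
    rw [hK, forced_of_not_isMin ht]
    have hb := mul_base_inv_eq hsub m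
    by_cases h : IsMin (Set.range (s ∘ k.succAbove)) (base (Set.range s) m)
    · rw [← hb, h.base_eq]
    · rw [(ih _ (chamberLT_base hs)).1 _ h, forced_of_not_isMin h, ← Module.End.mul_apply,
        ← map_mul]
      simp only [hb]
      congr 2
      group
  obtain ⟨u, hu1, hu2, hu3⟩ := exists_correction hcard m (C m - diff j q K)
    (fun s => by
      rw [Pi.sub_apply, map_sub, hC.1, diff_apply, pb_kill_pb_kill le_rfl])
    (by rw [map_sub, hd, diff_diff, sub_zero])
    fun s hs => by rw [Pi.sub_apply, hKd s hs, sub_self]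
  refine ⟨K + u, fun t ht => ?_, fun t => ?_, ?_⟩
  · rw [Pi.add_apply, hu1 t ht, Pi.zero_apply, add_zero]
  · rw [Pi.add_apply, map_add, hKk, hu2]
  · rw [map_add, hu3, add_sub_cancel]

theorem primitive_eq {q : ℕ} (hcard : 2 * (q + 1) + 1 + j ≤ Fintype.card α)
    {C : MulAut (FreeGroup α) → (Fin (q + 1) → α) → Form j (FreeGroup α)}
    (hC : C ∈ cplx α j (q + 1)) (hd : ∀ g, diff j (q + 1) (C g) = 0)
    (m : MulAut (FreeGroup α)) (t : Fin q → α) :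
    primitive C m t = formRep j _ (m * (base (Set.range t) m)⁻¹)
      (primitive C (base (Set.range t) m) t) := by
  by_cases h : IsMin (Set.range t) m
  · rw [h.base_eq, mul_inv_cancel, map_one, Module.End.one_apply]
  · rw [(isPrimitiveAt_primitive hcard hC hd m).1 t h, forced_of_not_isMin h]

end Exactness

theorem exists_diff_eq {α : Type} [Fintype α] {j q : ℕ}
    (hcard : 2 * (q + 1) + 1 + j ≤ Fintype.card α)
    {C : MulAut (FreeGroup α) → (Fin (q + 1) → α) → Form j (FreeGroup α)}
    (hC : C ∈ cplx α j (q + 1)) (hd : ∀ g, diff j (q + 1) (C g) = 0) :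
    ∃ E ∈ cplx α j q, ∀ g, diff j q (E g) = C g := by
  let _ : LinearOrder α := LinearOrder.lift' (Fintype.equivFin α) (Fintype.equivFin α).injective
  refine ⟨primitive C, ⟨fun g => (isPrimitiveAt_primitive hcard hC hd g).2.1,
    fun t ψ hψ g => ?_⟩, fun g => (isPrimitiveAt_primitive hcard hC hd g).2.2⟩
  rw [primitive_eq hcard hC hd (ψ * g), primitive_eq hcard hC hd g, base_mul hψ, mul_assoc,
    map_mul, Module.End.mul_apply]

end FreeForm

namespace FreeForm

open Classical GroupCochain TupleComplex

section Components

variable {α : Type} {j : ℕ}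

/-- Being the coboundary of a cochain with values in the equivariant functions. -/
def IsCplxCobd (α : Type) (j q : ℕ) : (r : ℕ) → ((Fin r → MulAut (FreeGroup α)) →
    MulAut (FreeGroup α) → (Fin q → α) → Form j (FreeGroup α)) → Prop
  | 0, f => f = 0
  | r + 1, f => ∃ e, (∀ g, e g ∈ cplx α j q) ∧ cobd (funRep _ _) r e = f

/-- Being the coboundary of a cochain with values in the equivariant functions that are cocycles
for the differential on tuples. -/
def IsClosedCobd (α : Type) (j q : ℕ) : (r : ℕ) → ((Fin r → MulAut (FreeGroup α)) →
    MulAut (FreeGroup α) → (Fin q → α) → Form j (FreeGroup α)) → Prop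
  | 0, f => f = 0
  | r + 1, f => ∃ e, (∀ g, e g ∈ cplx α j q) ∧ (∀ g x, diff j q (e g x) = 0) ∧
      cobd (funRep _ _) r e = f

theorem pb_inc_formRep_extAut {s : Set α} (ψ : MulAut (FreeGroup {i // i ∉ s}))
    (ω : Form j (FreeGroup α)) :
    pb j (inc s) (formRep j _ (extAut s ψ) ω) = formRep j _ ψ (pb j (inc s) ω) := by
  rw [formRep_eq, formRep_eq, pb_pb, pb_pb, ← map_inv]
  congr 2
  exact MonoidHom.ext fun w => extAut_inc _ w

theorem pb_ret_formRep {s : Set α} (ψ : MulAut (FreeGroup {i // i ∉ s}))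
    (ω : Form j (FreeGroup {i // i ∉ s})) :
    pb j (ret s) (formRep j _ ψ ω) = formRep j _ (extAut s ψ) (pb j (ret s) ω) := by
  rw [formRep_eq, formRep_eq, pb_pb, pb_pb, ← map_inv]
  congr 2
  exact MonoidHom.ext fun w => (ret_extAut ψ⁻¹ w).symm

theorem pb_ret_pb_inc {s : Set α} (ω : Form j (FreeGroup α)) :
    pb j (ret s) (pb j (inc s) ω) = pb j (kill s) ω := by
  rw [pb_pb, inc_comp_ret]

theorem pb_kill_pb_ret {s : Set α} (ω : Form j (FreeGroup {i // i ∉ s})) :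
    pb j (kill s) (pb j (ret s) ω) = pb j (ret s) ω := by
  rw [← pb_ret_pb_inc, pb_pb (ret s) (inc s), ret_comp_inc, pb_id]

theorem pb_inc_pb_kill {s : Set α} (ω : Form j (FreeGroup α)) :
    pb j (inc s) (pb j (kill s) ω) = pb j (inc s) ω := by
  rw [← pb_ret_pb_inc, pb_pb (ret s) (inc s), ret_comp_inc, pb_id]

theorem cobd_component {q r : ℕ} {F : Type} [Group F]
    (f : (Fin r → MulAut (FreeGroup α)) → MulAut (FreeGroup α) → (Fin q → α) → Form j F)
    (s : Fin q → α) :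
    cobd (funRep _ _) r (fun g x => f g x s) = fun g x => cobd (funRep _ _) r f g x s :=
  cobd_postcomp (Pi.evalAddMonoidHom (fun _ : Fin q → α => Form j F) s) r f

theorem isEqui_component {q : ℕ} {E : MulAut (FreeGroup α) → (Fin q → α) → Form j (FreeGroup α)}
    (hE : E ∈ cplx α j q) (s : Fin q → α) : IsEqui (extAut (Set.range s))
      (formRep j (FreeGroup {i // i ∉ Set.range s}))
      fun x => pb j (inc (Set.range s)) (E x s) := by
  intro ψ x
  simp only
  rw [hE.2 s _ (extAut_mem_stab ψ), pb_inc_formRep_extAut]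

theorem cobd_pb_inc_component {q r : ℕ}
    {f : (Fin r → MulAut (FreeGroup α)) → MulAut (FreeGroup α) → (Fin q → α) →
      Form j (FreeGroup α)} (hc : cobd (funRep _ _) r f = 0) (s : Fin q → α) :
    cobd (funRep _ _) r (fun g x => pb j (inc (Set.range s)) (f g x s)) = 0 := by
  rw [cobd_postcomp (pb j (inc (Set.range s))) r fun g x => f g x s, cobd_component, hc]
  ext g x : 2
  exact map_zero _

theorem cobd_eval_component {q r : ℕ}
    {f : (Fin r → MulAut (FreeGroup α)) → MulAut (FreeGroup α) → (Fin q → α) →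
      Form j (FreeGroup α)} (hf : ∀ g, f g ∈ cplx α j q) (hc : cobd (funRep _ _) r f = 0)
    (s : Fin q → α) :
    cobd (formRep j (FreeGroup {i // i ∉ Set.range s})) r
      (fun g => pb j (inc (Set.range s)) (f (extAut (Set.range s) ∘ g) 1 s)) = 0 := by
  rw [cobd_eval fun g => isEqui_component (hf g) s, cobd_pb_inc_component hc s]
  rfl

theorem isCplxCobd_of_components {q r : ℕ}
    {f : (Fin r → MulAut (FreeGroup α)) → MulAut (FreeGroup α) → (Fin q → α) →
      Form j (FreeGroup α)}
    (hf : ∀ g, f g ∈ cplx α j q) (hc : cobd (funRep _ _) r f = 0)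
    (h : ∀ s : Fin q → α, IsCobd (formRep j (FreeGroup {i // i ∉ Set.range s})) r
      fun g => pb j (inc (Set.range s)) (f (extAut (Set.range s) ∘ g) 1 s)) :
    IsCplxCobd α j q r f := by
  have key : ∀ s : Fin q → α, IsEquiCobd (extAut (Set.range s))
      (formRep j (FreeGroup {i // i ∉ Set.range s})) r
      fun g x => pb j (inc (Set.range s)) (f g x s) := by
    intro s
    exact isEquiCobd_of_eval extAut_injective r _ _ (fun g => isEqui_component (hf g) s)
      (cobd_pb_inc_component hc s) (h s)
  cases r with
  | zero =>
    ext g x s : 3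
    rw [← (hf g).1, ← pb_ret_pb_inc]
    have := congrFun (congrFun (key s) g) x
    exact (congrArg (pb j (ret (Set.range s))) this).trans (map_zero _)
  | succ r =>
    choose e he hef using key
    refine ⟨fun g x s => pb j (ret (Set.range s)) (e s g x),
      fun g => ⟨fun x s => pb_kill_pb_ret _, fun s ψ hψ x => ?_⟩, ?_⟩
    · obtain ⟨φ, rfl⟩ := exists_extAut_of_mem_stab hψ
      rw [← pb_ret_formRep]
      exact congrArg _ (he s g φ x)
    · ext g x s : 3
      refine (congrFun (congrFun (cobd_component _ s) g) x).symm.trans ?_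
      rw [cobd_postcomp (pb j (ret (Set.range s))) r (e s), hef]
      exact (pb_ret_pb_inc _).trans ((hf g).1 x s)

theorem cobd_diff {q r : ℕ} (f : (Fin r → MulAut (FreeGroup α)) → MulAut (FreeGroup α) →
    (Fin q → α) → Form j (FreeGroup α)) :
    cobd (funRep _ _) r (fun g x => diff j q (f g x)) =
      fun g x => diff j q (cobd (funRep _ _) r f g x) :=
  cobd_postcomp (diff j q) r f

theorem cobd_mem_cplx {q r : ℕ} {f : (Fin r → MulAut (FreeGroup α)) → MulAut (FreeGroup α) →
    (Fin q → α) → Form j (FreeGroup α)} (hf : ∀ g, f g ∈ cplx α j q)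
    (g : Fin (r + 1) → MulAut (FreeGroup α)) : cobd (funRep _ _) r f g ∈ cplx α j q := by
  have htrans : ∀ g : MulAut (FreeGroup α), ∀ E ∈ cplx α j q,
      funRep _ ((Fin q → α) → Form j (FreeGroup α)) g E ∈ cplx α j q := by
    rintro g E ⟨h1, h2⟩
    refine ⟨fun x s => h1 (x * g) s, fun s ψ hψ x => ?_⟩
    rw [funRep_apply, funRep_apply, mul_assoc, h2 s ψ hψ]
  rw [cobd_apply]
  exact add_mem (htrans _ _ (hf _)) (sum_mem fun i _ => zsmul_mem (hf _) _)

end Components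

section Vanishing

variable {α : Type} [Fintype α] {j : ℕ}

theorem isClosedCobd_of_isCplxCobd {q r : ℕ}
    {f : (Fin r → MulAut (FreeGroup α)) → MulAut (FreeGroup α) → (Fin q → α) →
      Form j (FreeGroup α)}
    (hd : ∀ g x, diff j q (f g x) = 0)
    (hcard : ∀ r', r = r' + 2 → 2 * (q + 1) + 1 + j ≤ Fintype.card α)
    (hnext : ∀ r', r = r' + 1 → ∀ f' : (Fin r' → MulAut (FreeGroup α)) → MulAut (FreeGroup α) →
      (Fin (q + 1) → α) → Form j (FreeGroup α), (∀ g, f' g ∈ cplx α j (q + 1)) →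
      cobd (funRep _ _) r' f' = 0 → (∀ g x, diff j (q + 1) (f' g x) = 0) →
      IsClosedCobd α j (q + 1) r' f')
    (h : IsCplxCobd α j q r f) : IsClosedCobd α j q r f := by
  cases r with
  | zero => exact h
  | succ r =>
    obtain ⟨e, he, hef⟩ := h
    have := hnext r rfl (fun g x => diff j q (e g x)) (fun g => diff_mem_cplx (he g))
      (by
        rw [cobd_diff, hef]
        ext g x : 2
        exact hd g x)
      (fun g x => diff_diff q _)
    cases r with
    | zero => exact ⟨e, he, fun g x => congrFun (congrFun this g) x, hef⟩
    | succ r =>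
      obtain ⟨e', he', hd', hef'⟩ := this
      choose b hb hbe using fun g => exists_diff_eq (hcard r rfl) (he' g) (hd' g)
      refine ⟨e - cobd (funRep _ _) r b, fun g => sub_mem (he g) (cobd_mem_cplx hb g),
        fun g x => ?_, by rw [map_sub, cobd_cobd, sub_zero, hef]⟩
      rw [Pi.sub_apply, Pi.sub_apply, map_sub, sub_eq_zero,
        ← congrFun (congrFun (cobd_diff b) g) x]
      simp only [hbe]
      exact (congrFun (congrFun hef' g) x).symm

theorem card_le_card_compl_range {q : ℕ} (s : Fin q → α) :
    Fintype.card α ≤ Fintype.card {i // i ∉ Set.range s} + q := by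
  have h1 := Fintype.card_subtype_compl (fun i => i ∈ Set.range s)
  have h2 : Fintype.card {i // i ∈ Set.range s} ≤ q := by
    exact (Fintype.card_le_of_surjective (Set.rangeFactorization s)
      Set.rangeFactorization_surjective).trans_eq (Fintype.card_fin q)
  omega

theorem isClosedCobd_of_van {k : ℕ} (hcard : 2 * k + j + 1 ≤ Fintype.card α)
    (ih : ∀ k' < k, ∀ β : Type, [Fintype β] → 2 * k' + j + 1 ≤ Fintype.card β →
      Van (formRep j (FreeGroup β)) k') (r : ℕ) :
    ∀ q, 2 ≤ q → r + q = k + 1 → ∀ f : (Fin r → MulAut (FreeGroup α)) → MulAut (FreeGroup α) →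
      (Fin q → α) → Form j (FreeGroup α), (∀ g, f g ∈ cplx α j q) →
      cobd (funRep _ _) r f = 0 → (∀ g x, diff j q (f g x) = 0) → IsClosedCobd α j q r f := by
  induction r using Nat.strong_induction_on with
  | _ r ihr =>
  intro q hq hrq f hf hc hd
  refine isClosedCobd_of_isCplxCobd hd (fun r' hr' => by omega)
    (fun r' hr' => ihr r' (by omega) (q + 1) (by omega) (by omega))
    (isCplxCobd_of_components hf hc fun s => ?_)
  have hs := card_le_card_compl_range s
  exact ih r (by omega) {i // i ∉ Set.range s} (by omega) _ (cobd_eval_component hf hc s)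

end Vanishing

section Augmentation

variable {α : Type} {j : ℕ}

theorem pb_kill_empty (ω : Form j (FreeGroup α)) : pb j (kill ∅) ω = ω := by
  have : kill (∅ : Set α) = MonoidHom.id _ :=
    FreeGroup.ext_hom _ _ fun a => kill_of_notMem (Set.notMem_empty a)
  rw [this, pb_id]

theorem mem_stab_empty (ψ : MulAut (FreeGroup α)) : ψ ∈ stab (∅ : Set α) := by
  have : kill (∅ : Set α) = MonoidHom.id _ :=
    FreeGroup.ext_hom _ _ fun a => kill_of_notMem (Set.notMem_empty a)
  exact ⟨fun i hi => hi.elim, fun w => by rw [this]; rfl⟩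

/-- The equivariant embedding of forms into the functions with values in `0`-tuples of forms. -/
def augment (j : ℕ) (α : Type) : Form j (FreeGroup α) →+
    (MulAut (FreeGroup α) → (Fin 0 → α) → Form j (FreeGroup α)) :=
  AddMonoidHom.mk' (fun ω x _ => formRep j _ x ω) fun ω ω' => by
    ext x t : 2
    exact map_add _ _ _

theorem augment_apply (ω : Form j (FreeGroup α)) (x : MulAut (FreeGroup α)) (t : Fin 0 → α) :
    augment j α ω x t = formRep j _ x ω := rfl

theorem cobd_augment {k : ℕ} (c : (Fin k → MulAut (FreeGroup α)) → Form j (FreeGroup α)) :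
    cobd (funRep _ _) k (fun g => augment j α (c g)) =
      fun g => augment j α (cobd (formRep j _) k c g) :=
  cobd_map (formRep j _) (funRep _ _) (augment j α) (fun g ω => by
    ext x t : 2
    rw [augment_apply, funRep_apply, augment_apply, map_mul, Module.End.mul_apply]) k c

theorem augment_mem_cplx (ω : Form j (FreeGroup α)) : augment j α ω ∈ cplx α j 0 := by
  refine ⟨fun g s => ?_, fun s ψ _ g => ?_⟩
  · rw [Set.range_eq_empty s, pb_kill_empty]
  · rw [augment_apply, augment_apply, map_mul, Module.End.mul_apply]

theorem augment_injective : Function.Injective (augment j α) := by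
  intro ω ω' h
  have := congrFun (congrFun h 1) default
  rwa [augment_apply, augment_apply, map_one] at this

theorem exists_augment_eq {E : MulAut (FreeGroup α) → (Fin 0 → α) → Form j (FreeGroup α)}
    (hE : E ∈ cplx α j 0) : ∃ ω, augment j α ω = E := by
  refine ⟨E 1 default, ?_⟩
  ext x t : 2
  rw [augment_apply, Subsingleton.elim t default,
    ← hE.2 default x (by rw [Set.range_eq_empty]; exact mem_stab_empty x), mul_one]

end Augmentation

theorem van_formRep_succ {α : Type} [Fintype α] {j k : ℕ}
    (hcard : 2 * k + (j + 1) + 1 ≤ Fintype.card α)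
    (ih : ∀ k' < k, ∀ (i : ℕ) (β : Type) [Fintype β], 2 * k' + (i + 1) + 1 ≤ Fintype.card β →
      Van (formRep (i + 1) (FreeGroup β)) k') :
    Van (formRep (j + 1) (FreeGroup α)) k := by
  intro c hc
  have hinj : ∀ f : (Fin k → MulAut (FreeGroup α)) → MulAut (FreeGroup α) → (Fin 0 → α) →
      Form (j + 1) (FreeGroup α), (∀ g x, diff (j + 1) 0 (f g x) = 0) → f = 0 :=
    fun f hf => funext fun g => eq_zero_of_diff_eq_zero (by omega) (hf g)
  have hcob : cobd (funRep _ _) k (fun g => augment (j + 1) α (c g)) = 0 := by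
    rw [cobd_augment, hc]
    ext g : 1
    exact map_zero _
  have hclosed : IsClosedCobd α (j + 1) 1 k
      fun g x => diff (j + 1) 0 (augment (j + 1) α (c g) x) := by
    have hmem := fun g => diff_mem_cplx (augment_mem_cplx (c g))
    have hcob' : cobd (funRep _ _) k
        (fun g x => diff (j + 1) 0 (augment (j + 1) α (c g) x)) = 0 := by
      rw [cobd_diff, hcob]
      ext g x : 2
      exact map_zero _
    refine isClosedCobd_of_isCplxCobd (fun g x => diff_diff 0 _) (fun r' hr' => by omega)
      (fun r' hr' => isClosedCobd_of_van hcard (fun k' hk' β _ => ih k' hk' j β) r' 2 le_rfl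
        (by omega))
      (isCplxCobd_of_components hmem hcob' fun s => ?_)
    have hs := card_le_card_compl_range s
    have := isCobd_restrict (s := Set.range s) ⟨0, rfl⟩ k
      (fun k' hk' => ih k' (by omega) (j + 1) {i // i ∉ Set.range s} (by omega)) c hc
    simp only [diff_apply, face_zero_apply, pb_inc_pb_kill, augment_apply, map_one]
    exact this
  cases k with
  | zero =>
    have := hinj _ fun g x => congrFun (congrFun hclosed g) x
    ext g : 1
    exact augment_injective ((congrFun this g).trans (map_zero _).symm)
  | succ k =>
    obtain ⟨b, hb, hbd, hbc⟩ := hclosed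
    choose e he heb using fun g => exists_diff_eq (by omega) (hb g) (hbd g)
    choose ω hω using fun g => exists_augment_eq (he g)
    refine ⟨ω, ?_⟩
    ext g : 1
    refine augment_injective ?_
    have := hinj ((fun g => augment (j + 1) α (c g)) - cobd (funRep _ _) k e) fun g x => by
      rw [Pi.sub_apply, Pi.sub_apply, map_sub, sub_eq_zero,
        ← congrFun (congrFun (cobd_diff e) g) x]
      simp only [heb]
      exact (congrFun (congrFun hbc g) x).symm
    rw [← congrFun (cobd_augment ω) g]
    simp only [hω]
    exact (congrFun (sub_eq_zero.1 this) g).symm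

theorem van_formRep (k : ℕ) : ∀ (j : ℕ) (α : Type) [Fintype α],
    2 * k + (j + 1) + 1 ≤ Fintype.card α → Van (formRep (j + 1) (FreeGroup α)) k := by
  induction k using Nat.strong_induction_on with
  | _ k ih => exact fun j α _ hcard => van_formRep_succ hcard ih

end FreeForm

namespace FreeForm

/-- The linear form on a group that is induced by a linear form on its abelianization. -/
def formOfDual (n : ℕ) : Module.Dual ℤ (AbH n) →+ Form 1 (FreeGrp n) :=
  AddMonoidHom.mk' (fun d => ⟨fun y => d (Additive.ofMul (Abelianization.of (y 0))), by
    intro y l u v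
    simp only [Subsingleton.elim l 0, Function.update_self, map_mul, ofMul_mul, map_add]⟩)
    fun _ _ => rfl

theorem formOfDual_apply {n : ℕ} (d : Module.Dual ℤ (AbH n)) (y : Fin 1 → FreeGrp n) :
    (formOfDual n d).1 y = d (Additive.ofMul (Abelianization.of (y 0))) := rfl

theorem formOfDual_bijective (n : ℕ) : Function.Bijective (formOfDual n) := by
  constructor
  · intro d d' h
    ext x
    obtain ⟨w, rfl⟩ := QuotientGroup.mk_surjective x.toMul
    have := congrFun (congrArg Subtype.val h) fun _ => w
    exact this
  · intro ω
    have hmul : ∀ u v : FreeGrp n, ω.1 (fun _ => u * v) = ω.1 (fun _ => u) + ω.1 fun _ => v := by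
      intro u v
      have hupd : ∀ w : FreeGrp n, Function.update (fun _ : Fin 1 => (1 : FreeGrp n)) 0 w =
          fun _ => w := by
        intro w
        ext l : 1
        rw [Subsingleton.elim l 0, Function.update_self]
      have := ω.2 (fun _ => 1) 0 u v
      rwa [hupd, hupd, hupd] at this
    let φ : FreeGrp n →* Multiplicative ℤ :=
      MonoidHom.mk' (fun u => Multiplicative.ofAdd (ω.1 fun _ => u)) hmul
    refine ⟨(MonoidHom.toAdditiveLeft (Abelianization.lift φ)).toIntLinearMap, ?_⟩
    ext y
    rw [formOfDual_apply]
    change Multiplicative.toAdd (Abelianization.lift φ (Abelianization.of (y 0))) = ω.1 y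
    rw [Abelianization.lift_apply_of]
    exact congrArg ω.1 (funext fun l => congrArg y (Subsingleton.elim 0 l))

theorem formOfDual_equivariant {n : ℕ} (g : AutF n) (d : Module.Dual ℤ (AbH n)) :
    formOfDual n ((abRep n).dual g d) = formRep 1 _ g (formOfDual n d) := rfl

theorem van_dual_abRep {n i : ℕ} (h : 2 * i + 4 ≤ n) : GroupCochain.Van (abRep n).dual i := by
  refine GroupCochain.Van.transport (MulEquiv.refl _)
    (AddEquiv.ofBijective _ (formOfDual_bijective n)).symm (fun g ω => ?_)
    (van_formRep i 0 (Fin n) (by rw [Fintype.card_fin]; omega))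
  rw [AddEquiv.symm_apply_eq]
  refine Eq.trans ?_ (formOfDual_equivariant g _).symm
  exact congrArg (formRep 1 _ g) (AddEquiv.apply_symm_apply
    (AddEquiv.ofBijective _ (formOfDual_bijective n)) ω).symm

end FreeForm

/-- For every `n` and every degree `i ≥ 0` with `2i ≤ n - 4`, the group
cohomology `H^i(Aut(F_n); H^*)` vanishes. -/
theorem stmt1 (n : ℕ) (i : ℕ) (h : 2 * i + 4 ≤ n) :
    Limits.IsZero (groupCohomology (dualRepAut n) i) := by
  exact GroupCochain.isZero_of_van _ i (FreeForm.van_dual_abRep h)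
end
end

section
/- For every n ≥ 1 and every q ≥ 1, the submodule of Aut(F_n)-invariants in the q-th exterior power Λ^q H of the abelianization H of the free group F_n is zero (so the invariants of the full exterior algebra Λ^* H are exactly Z, concentrated in degree zero). -/
open CategoryTheory

noncomputable section

section ExtPower

variable {R M N : Type} [CommRing R] [AddCommGroup M] [Module R M] [AddCommGroup N] [Module R N]

lemma extPower_map_mem (f : M →ₗ[R] N) (q : ℕ) {x : ExteriorAlgebra R M}
    (hx : x ∈ ⋀[R]^q M) : ExteriorAlgebra.map f x ∈ ⋀[R]^q N := by
  rw [← ExteriorAlgebra.ιMulti_span_fixedDegree] at hx ⊢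
  induction hx using Submodule.span_induction with
  | mem y hy =>
      obtain ⟨m, rfl⟩ := hy
      rw [ExteriorAlgebra.map_apply_ιMulti]
      exact Submodule.subset_span ⟨f ∘ m, rfl⟩
  | zero => simp
  | add y z _ _ hy hz => rw [map_add]; exact Submodule.add_mem _ hy hz
  | smul r y _ hy => rw [map_smul]; exact Submodule.smul_mem _ r hy

/-- The map induced by a linear map on the `q`-th exterior powers. -/
def extPowerMap (f : M →ₗ[R] N) (q : ℕ) : ⋀[R]^q M →ₗ[R] ⋀[R]^q N :=
  (ExteriorAlgebra.map f).toLinearMap.restrict (fun x hx => extPower_map_mem f q hx)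

variable {G : Type} [Group G]

/-- The representation induced on the `q`-th exterior power of a representation. -/
def extPowerRep (ρ : Representation R G M) (q : ℕ) : Representation R G (⋀[R]^q M) where
  toFun g := extPowerMap (ρ g) q
  map_one' := by
    apply LinearMap.ext
    intro x
    apply Subtype.ext
    show ExteriorAlgebra.map (ρ 1) (x : ExteriorAlgebra R M) = (x : ExteriorAlgebra R M)
    rw [map_one, show (1 : M →ₗ[R] M) = LinearMap.id from rfl, ExteriorAlgebra.map_id]
    rfl
  map_mul' g g' := by
    apply LinearMap.ext
    intro x
    apply Subtype.ext
    show ExteriorAlgebra.map (ρ (g * g')) (x : ExteriorAlgebra R M) =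
      ExteriorAlgebra.map (ρ g) (ExteriorAlgebra.map (ρ g') (x : ExteriorAlgebra R M))
    rw [map_mul, show ρ g * ρ g' = (ρ g).comp (ρ g') from rfl,
      ← ExteriorAlgebra.map_comp_map]
    rfl

end ExtPower

namespace exteriorPower

lemma repr_map_of_diagonal {R M I : Type*} [CommRing R] [AddCommGroup M] [Module R M]
    [LinearOrder I] (b : Module.Basis I R M) {f : M →ₗ[R] M} {c : I → R}
    (hf : ∀ i, f (b i) = c i • b i) (q : ℕ) (x : ⋀[R]^q M) (s : Set.powersetCard I q) :
    (b.exteriorPower q).repr (map q f x) s =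
      (∏ k, c (Set.powersetCard.ofFinEmbEquiv.symm s k)) * (b.exteriorPower q).repr x s := by
  have map_basis (t : Set.powersetCard I q) : map q f (b.exteriorPower q t) =
      (∏ k, c (Set.powersetCard.ofFinEmbEquiv.symm t k)) • b.exteriorPower q t := by
    rw [basis_apply, ιMulti_family, map_apply_ιMulti]
    exact (congrArg (ιMulti R q) (funext fun k => hf _)).trans
      ((ιMulti R q).toMultilinearMap.map_smul_univ _ _)
  suffices (b.exteriorPower q).coord s ∘ₗ map q f =
      (∏ k, c (Set.powersetCard.ofFinEmbEquiv.symm s k)) • (b.exteriorPower q).coord s from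
    LinearMap.congr_fun this x
  refine (b.exteriorPower q).ext fun t => ?_
  by_cases h : t = s
  · subst h
    simp only [LinearMap.comp_apply, map_basis, map_smul, LinearMap.smul_apply]
  · simp only [LinearMap.comp_apply, map_basis, map_smul, LinearMap.smul_apply,
      Module.Basis.coord_apply, Module.Basis.repr_self, Finsupp.single_eq_of_ne' h, smul_zero]

end exteriorPower

lemma extPowerMap_eq_map {R M N : Type} [CommRing R] [AddCommGroup M] [Module R M]
    [AddCommGroup N] [Module R N] (f : M →ₗ[R] N) (q : ℕ) :
    extPowerMap f q = exteriorPower.map q f := by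
  refine exteriorPower.linearMap_ext (AlternatingMap.ext fun v => Subtype.ext ?_)
  simp only [LinearMap.compAlternatingMap_apply, exteriorPower.map_apply_ιMulti]
  exact ExteriorAlgebra.map_apply_ιMulti f v

/-- The basis of the abelianization of `F_n` given by the classes of the generators. -/
def abBasis (n : ℕ) : Module.Basis (Fin n) ℤ (AbH n) :=
  ⟨(FreeAbelianGroup.equivFinsupp (Fin n)).toIntLinearEquiv⟩

lemma abBasis_apply (n : ℕ) (i : Fin n) :
    abBasis n i = Additive.ofMul (Abelianization.of (FreeGroup.of i)) :=
  (LinearEquiv.symm_apply_eq _).2 (FreeAbelianGroup.toFinsupp_of i).symm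

/-- The automorphism of a free group which inverts the generator `i` and fixes the others. -/
def invGenerator {α : Type*} [DecidableEq α] (i : α) : MulAut (FreeGroup α) :=
  let f : FreeGroup α →* FreeGroup α :=
    FreeGroup.lift fun j => if j = i then (FreeGroup.of j)⁻¹ else FreeGroup.of j
  have hf : f.comp f = MonoidHom.id _ := by
    ext j
    by_cases h : j = i <;> simp [f, h]
  f.toMulEquiv f hf hf

lemma invGenerator_of {α : Type*} [DecidableEq α] (i j : α) :
    invGenerator i (FreeGroup.of j) =
      if j = i then (FreeGroup.of j)⁻¹ else FreeGroup.of j :=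
  FreeGroup.lift_apply_of

lemma abRep_invGenerator (n : ℕ) (i j : Fin n) :
    abRep n (invGenerator i) (abBasis n j) = (if j = i then -1 else 1 : ℤ) • abBasis n j := by
  rw [abBasis_apply]
  change Additive.ofMul (Abelianization.of (invGenerator i (FreeGroup.of j))) = _
  rw [invGenerator_of]
  split_ifs <;> simp

/-- For every `n ≥ 1` and every `q ≥ 1`, the submodule of
`Aut(F_n)`-invariants in the `q`-th exterior power `Λ^q H` of the abelianization `H` of the
free group `F_n` is zero. -/
theorem stmt5 (n : ℕ) (hn : 1 ≤ n) (q : ℕ) (hq : 1 ≤ q) :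
    (extPowerRep (abRep n) q).invariants = ⊥ := by
  refine (Submodule.eq_bot_iff _).2 fun x hx => ?_
  refine ((abBasis n).exteriorPower q).ext_elem fun s => ?_
  let e := Set.powersetCard.ofFinEmbEquiv.symm s
  let i := e ⟨0, hq⟩
  have hfix : exteriorPower.map q (abRep n (invGenerator i)) x = x := by
    rw [← extPowerMap_eq_map]
    exact hx (invGenerator i)
  have hprod : ∏ k, (if e k = i then -1 else 1 : ℤ) = -1 := by
    simp [i]
  have h := exteriorPower.repr_map_of_diagonal (abBasis n) (abRep_invGenerator n i) q x s
  rw [hfix, hprod] at h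
  rw [map_zero, Finsupp.zero_apply]
  lia
end
end
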